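/- arXiv:1704.01876 — 4 statements merged into one kernel-verified Lean document; each statement's English description precedes it below -/
import Mathlib

section
/- Let A be a non-negative operator in a Banach space X with D := closure(D(A)), such that -A_D generates a bounded C₀-semigroup (T(t)) on D. For x ∈ D(A), the function u(t) := U(t)x (with U(t)x = (1/Γ(α))(t/2)^{2α} ∫_0^∞ r^{-α-1} e^{-t²/(4r)} T(r)x dr for t > 0, u(0) = x) satisfies u(t) ∈ D(A) and u''(t) + ((1-2α)/t) u'(t) = A u(t) for all t > 0. -/
open MeasureTheory Set

open Filter Topology

/-- The subordination kernel `r ↦ r ^ p * exp (-t² / (4 r))`. -/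
noncomputable def gaussKernel (p : ℂ) (t r : ℝ) : ℂ :=
  (r : ℂ) ^ p * (Real.exp (-(t ^ 2) / (4 * r)) : ℂ)

theorem norm_gaussKernel (p : ℂ) (t : ℝ) {r : ℝ} (hr : 0 < r) :
    ‖gaussKernel p t r‖ = r ^ p.re * Real.exp (-(t ^ 2) / (4 * r)) := by
  rw [gaussKernel, norm_mul, Complex.norm_cpow_eq_rpow_re_of_pos hr, Complex.norm_real,
    Real.norm_of_nonneg (Real.exp_pos _).le]

theorem gaussKernel_sub_one (p : ℂ) (t : ℝ) {r : ℝ} (hr : 0 < r) :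
    gaussKernel (p - 1) t r = gaussKernel p t r / r := by
  have : (r : ℂ) ≠ 0 := by exact_mod_cast hr.ne'
  rw [gaussKernel, gaussKernel, Complex.cpow_sub _ _ this, Complex.cpow_one]
  ring

theorem hasDerivAt_gaussKernel_left (p : ℂ) (t : ℝ) {r : ℝ} (hr : 0 < r) :
    HasDerivAt (fun s => gaussKernel p s r) (-(t / 2 : ℂ) * gaussKernel (p - 1) t r) t := by
  have h : HasDerivAt (fun s : ℝ => -(s ^ 2) / (4 * r)) (-(2 * t) / (4 * r)) t := by
    simpa using ((hasDerivAt_pow 2 t).neg.div_const (4 * r))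
  convert! (h.exp.ofReal_comp).const_mul ((r : ℂ) ^ p) using 1
  rw [gaussKernel_sub_one p t hr, gaussKernel]
  have : (r : ℂ) ≠ 0 := by exact_mod_cast hr.ne'
  push_cast
  field_simp
  ring

theorem hasDerivAt_gaussKernel_right {p : ℂ} (hp : p ≠ 0) (t : ℝ) {r : ℝ} (hr : 0 < r) :
    HasDerivAt (fun s => gaussKernel p t s)
      (p * gaussKernel (p - 1) t r + (t ^ 2 / 4 : ℂ) * gaussKernel (p - 2) t r) r := by
  have h : HasDerivAt (fun s : ℝ => -(t ^ 2) / (4 * s)) (t ^ 2 / (4 * r ^ 2)) r := by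
    convert! ((hasDerivAt_id r).const_mul 4).inv (by simpa using hr.ne') |>.const_mul (-(t ^ 2))
      using 1
    simp only [id]
    field_simp
  convert! (hasDerivAt_ofReal_cpow_const hr.ne' hp).mul h.exp.ofReal_comp using 1
  have : (r : ℂ) ≠ 0 := by exact_mod_cast hr.ne'
  rw [show p - 2 = p - 1 - 1 by ring, gaussKernel_sub_one (p - 1) t hr,
    gaussKernel_sub_one p t hr, gaussKernel, Complex.cpow_sub _ _ this, Complex.cpow_one]
  push_cast
  field_simp

theorem continuousOn_gaussKernel (p : ℂ) (t : ℝ) :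
    ContinuousOn (gaussKernel p t) (Ioi 0) := by
  intro r hr
  have hr' : (0 : ℝ) < r := hr
  refine ContinuousAt.continuousWithinAt (ContinuousAt.mul
    (Complex.continuousAt_ofReal_cpow_const _ _ (Or.inr hr'.ne')) ?_)
  refine (Complex.continuous_ofReal.comp Real.continuous_exp).continuousAt.comp ?_
  exact continuousAt_const.div (by fun_prop) (by positivity)

theorem integrableOn_rpow_mul_exp_neg_div {p c : ℝ} (hp : p < -1) (hc : 0 < c) :
    IntegrableOn (fun r : ℝ => r ^ p * Real.exp (-c / r)) (Ioi 0) := by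
  have h := (integrableOn_Ioi_comp_rpow_iff' (fun y : ℝ => y ^ (-p - 2) * Real.exp (-c * y ^ (1 : ℝ)))
    (p := -1) (by norm_num)).2
    (integrableOn_rpow_mul_exp_neg_mul_rpow (by linarith) one_pos hc)
  refine h.congr_fun (fun r hr => ?_) measurableSet_Ioi
  have hr : (0 : ℝ) < r := hr
  simp only [smul_eq_mul, Real.rpow_one]
  rw [← Real.rpow_mul hr.le, ← mul_assoc, ← Real.rpow_add hr, Real.rpow_neg_one,
    ← div_eq_mul_inv]
  ring_nf

theorem integrableOn_norm_gaussKernel {p : ℂ} (hp : p.re < -1) {t : ℝ} (ht : 0 < t) :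
    IntegrableOn (fun r => ‖gaussKernel p t r‖) (Ioi 0) := by
  refine (integrableOn_rpow_mul_exp_neg_div hp (c := t ^ 2 / 4) (by positivity)).congr_fun
    (fun r hr => ?_) measurableSet_Ioi
  have hr : (0 : ℝ) < r := hr
  simp only [norm_gaussKernel p t hr]
  congr 2
  field_simp

theorem tendsto_gaussKernel_nhdsGT_zero (p : ℂ) {t : ℝ} (ht : 0 < t) :
    Tendsto (gaussKernel p t) (𝓝[>] 0) (𝓝 0) := by
  rw [tendsto_zero_iff_norm_tendsto_zero]
  refine ((tendsto_rpow_mul_exp_neg_mul_atTop_nhds_zero (-p.re) (t ^ 2 / 4)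
    (by positivity)).comp tendsto_inv_nhdsGT_zero).congr' ?_
  filter_upwards [self_mem_nhdsWithin] with r hr
  have hr : (0 : ℝ) < r := hr
  rw [norm_gaussKernel p t hr, Function.comp, Real.inv_rpow hr.le, Real.rpow_neg hr.le, inv_inv]
  congr 2
  field_simp

theorem tendsto_gaussKernel_atTop {p : ℂ} (hp : p.re < 0) (t : ℝ) :
    Tendsto (gaussKernel p t) atTop (𝓝 0) := by
  refine squeeze_zero_norm' (a := fun r : ℝ => r ^ p.re) ?_ ?_
  · filter_upwards [eventually_gt_atTop 0] with r hr
    rw [norm_gaussKernel p t hr]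
    refine mul_le_of_le_one_right (Real.rpow_nonneg hr.le _) (Real.exp_le_one_iff.2 ?_)
    rw [neg_div]
    exact neg_nonpos.2 (by positivity)
  · simpa using tendsto_rpow_neg_atTop (y := -p.re) (by linarith)

section Transform

variable {X : Type*} [NormedAddCommGroup X] [NormedSpace ℂ X]
  {g : ℝ → X} {C : ℝ} {p : ℂ} {t : ℝ}

theorem integrableOn_gaussKernel_smul (hg : ContinuousOn g (Ioi 0))
    (hC : ∀ r, 0 < r → ‖g r‖ ≤ C) (hp : p.re < -1) (ht : 0 < t) :
    IntegrableOn (fun r => gaussKernel p t r • g r) (Ioi 0) := by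
  refine Integrable.mono' ((integrableOn_norm_gaussKernel hp ht).mul_const C)
    (((continuousOn_gaussKernel p t).smul hg).aestronglyMeasurable measurableSet_Ioi) ?_
  filter_upwards [ae_restrict_mem measurableSet_Ioi] with r hr
  rw [norm_smul]
  exact mul_le_mul_of_nonneg_left (hC r hr) (norm_nonneg _)

theorem hasDerivAt_integral_gaussKernel_smul (hg : ContinuousOn g (Ioi 0))
    (hC : ∀ r, 0 < r → ‖g r‖ ≤ C) (hp : p.re < -1) (ht : 0 < t) :
    HasDerivAt (fun s => ∫ r in Ioi (0 : ℝ), gaussKernel p s r • g r)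
      (-(t / 2 : ℂ) • ∫ r in Ioi (0 : ℝ), gaussKernel (p - 1) t r • g r) t := by
  have hp' : (p - 1).re < -1 := by simp; linarith
  have hmeas : ∀ q s, AEStronglyMeasurable (fun r => gaussKernel q s r • g r)
      (volume.restrict (Ioi 0)) := fun q s =>
    ((continuousOn_gaussKernel q s).smul hg).aestronglyMeasurable measurableSet_Ioi
  have key := (hasDerivAt_integral_of_dominated_loc_of_deriv_le
    (μ := volume.restrict (Ioi (0 : ℝ))) (F := fun s r => gaussKernel p s r • g r)
    (F' := fun s r => -(s / 2 : ℂ) • gaussKernel (p - 1) s r • g r)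
    (bound := fun r => t * (‖gaussKernel (p - 1) (t / 2) r‖ * C))
    (s := Ioo (t / 2) (2 * t)) (Ioo_mem_nhds (by linarith) (by linarith))
    (Eventually.of_forall (hmeas p)) (integrableOn_gaussKernel_smul hg hC hp ht)
    ((hmeas (p - 1) t).const_smul _) ?_
    (((integrableOn_norm_gaussKernel hp' (half_pos ht)).mul_const C).const_mul t) ?_).2
  · rwa [integral_smul] at key
  · filter_upwards [ae_restrict_mem measurableSet_Ioi] with r hr s hs
    have hr : (0 : ℝ) < r := hr
    have hs0 : 0 < s := (half_pos ht).trans hs.1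
    rw [norm_smul, norm_smul]
    have h1 : ‖-(s / 2 : ℂ)‖ ≤ t := by
      rw [norm_neg, norm_div, Complex.norm_real, Real.norm_of_nonneg hs0.le]
      norm_num
      linarith [hs.2]
    have h2 : ‖gaussKernel (p - 1) s r‖ ≤ ‖gaussKernel (p - 1) (t / 2) r‖ := by
      rw [norm_gaussKernel _ _ hr, norm_gaussKernel _ _ hr]
      have : (t / 2) ^ 2 ≤ s ^ 2 := pow_le_pow_left₀ (half_pos ht).le hs.1.le 2
      gcongr
    have := hC r hr
    gcongr
  · filter_upwards [ae_restrict_mem measurableSet_Ioi] with r hr s hs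
    simpa only [smul_smul] using (hasDerivAt_gaussKernel_left p s hr).smul_const (g r)

variable [CompleteSpace X]

/-- Integration by parts against the subordination kernel: all boundary terms vanish. -/
theorem integral_gaussKernel_smul_deriv {g' : ℝ → X} {C' : ℝ}
    (hg : ContinuousOn g (Ioi 0)) (hg' : ContinuousOn g' (Ioi 0))
    (hC : ∀ r, 0 < r → ‖g r‖ ≤ C) (hC' : ∀ r, 0 < r → ‖g' r‖ ≤ C')
    (hd : ∀ r, 0 < r → HasDerivAt g (g' r) r) (hp : p.re < -1) (ht : 0 < t) :
    (∫ r in Ioi (0 : ℝ), gaussKernel p t r • g' r) +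
      (p • (∫ r in Ioi (0 : ℝ), gaussKernel (p - 1) t r • g r) +
        (t ^ 2 / 4 : ℂ) • ∫ r in Ioi (0 : ℝ), gaussKernel (p - 2) t r • g r) = 0 := by
  have hp0 : p ≠ 0 := by rintro rfl; norm_num at hp
  have i0 := integrableOn_gaussKernel_smul hg' hC' hp ht
  have i1 := (integrableOn_gaussKernel_smul hg hC (p := p - 1) (by simp; linarith) ht).fun_smul p
  have i2 := (integrableOn_gaussKernel_smul hg hC (p := p - 2) (by simp; linarith) ht).fun_smul
    (t ^ 2 / 4 : ℂ)
  have hlim : ∀ l : Filter ℝ, Tendsto (gaussKernel p t) l (𝓝 0) → (∀ᶠ r in l, 0 < r) →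
      Tendsto (fun r => gaussKernel p t r • g r) l (𝓝 0) := by
    intro l hl hpos
    refine squeeze_zero_norm' (a := fun r => ‖gaussKernel p t r‖ * C) ?_
      (by simpa using hl.norm.mul_const C)
    filter_upwards [hpos] with r hr
    rw [norm_smul]
    exact mul_le_mul_of_nonneg_left (hC r hr) (norm_nonneg _)
  have hzero : gaussKernel p t 0 • g 0 = 0 := by
    simp [gaussKernel, Complex.zero_cpow hp0]
  rw [← integral_smul, ← integral_smul, ← integral_add i1 i2, ← integral_add i0 (i1.fun_add i2)]
  have hFTC := integral_Ioi_of_hasDerivAt_of_tendsto (a := (0 : ℝ)) (m := 0)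
    (f := fun r => gaussKernel p t r • g r)
    (f' := fun r => gaussKernel p t r • g' r +
      (p • gaussKernel (p - 1) t r • g r + (t ^ 2 / 4 : ℂ) • gaussKernel (p - 2) t r • g r))
    ?_ ?_ (i0.add (i1.fun_add i2))
    (hlim _ (tendsto_gaussKernel_atTop (by linarith) t) (eventually_gt_atTop 0))
  · rw [hzero, sub_zero] at hFTC
    exact hFTC
  · rw [← continuousWithinAt_Ioi_iff_Ici, ContinuousWithinAt, hzero]
    exact hlim _ (tendsto_gaussKernel_nhdsGT_zero p ht) self_mem_nhdsWithin
  · intro r hr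
    convert! (hasDerivAt_gaussKernel_right hp0 t hr).smul (hd r hr) using 1
    simp only [smul_smul, add_smul]

end Transform

/-- If `g' = -A g` on `(0, ∞)`, then the kernel transform of `g` lies in the domain of `A`. -/
theorem integral_gaussKernel_smul_mem_domain {X : Type*} [NormedAddCommGroup X]
    [NormedSpace ℂ X] [CompleteSpace X] (A : X →ₗ.[ℂ] X) (R : X →L[ℂ] X)
    (hR : ∀ y : X, ∃ h : R y ∈ A.domain, A ⟨R y, h⟩ + R y = y)
    (hRinv : ∀ x : A.domain, R (A x + (x : X)) = x)
    {g : ℝ → X} {C : ℝ} (hC : ∀ r, 0 < r → ‖g r‖ ≤ C)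
    (hd : ∀ r, 0 < r → ∃ h : g r ∈ A.domain, HasDerivAt g (-(A ⟨g r, h⟩)) r)
    {p : ℂ} (hp : p.re < -1) {t : ℝ} (ht : 0 < t) :
    ∃ h : (∫ r in Ioi (0 : ℝ), gaussKernel p t r • g r) ∈ A.domain,
      A ⟨_, h⟩ = p • (∫ r in Ioi (0 : ℝ), gaussKernel (p - 1) t r • g r) +
        (t ^ 2 / 4 : ℂ) • ∫ r in Ioi (0 : ℝ), gaussKernel (p - 2) t r • g r := by
  have hg : ContinuousOn g (Ioi 0) := fun r hr =>
    (hd r hr).choose_spec.continuousAt.continuousWithinAt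
  have hRg : ContinuousOn (fun r => R (g r)) (Ioi 0) := R.continuous.comp_continuousOn hg
  have hRC : ∀ r, 0 < r → ‖R (g r)‖ ≤ ‖R‖ * C := fun r hr =>
    (R.le_opNorm _).trans (mul_le_mul_of_nonneg_left (hC r hr) (norm_nonneg _))
  have hRd : ∀ r, 0 < r → HasDerivAt (fun r => R (g r)) (R (g r) - g r) r := by
    intro r hr
    obtain ⟨h, hr'⟩ := hd r hr
    convert! (R.restrictScalars ℝ).hasFDerivAt.comp_hasDerivAt r hr' using 1
    have := hRinv ⟨g r, h⟩
    rw [map_add] at this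
    simp only [ContinuousLinearMap.coe_restrictScalars', map_neg]
    rw [eq_sub_of_add_eq this]
    simp
  have parts := integral_gaussKernel_smul_deriv hRg (hRg.sub hg) hRC
    (C' := ‖R‖ * C + C) (fun r hr => (norm_sub_le _ _).trans (add_le_add (hRC r hr) (hC r hr)))
    hRd hp ht
  have i0 := integrableOn_gaussKernel_smul hg hC hp ht
  have comm : ∀ q : ℂ, q.re < -1 → (∫ r in Ioi (0 : ℝ), gaussKernel q t r • R (g r)) =
      R (∫ r in Ioi (0 : ℝ), gaussKernel q t r • g r) := by
    intro q hq
    rw [← R.integral_comp_comm (integrableOn_gaussKernel_smul hg hC hq ht)]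
    simp only [map_smul]
  simp only [Pi.sub_apply, smul_sub] at parts
  rw [integral_sub (integrableOn_gaussKernel_smul hRg hRC hp ht) i0, comm p hp,
    comm (p - 1) (by simp; linarith), comm (p - 2) (by simp; linarith),
    ← map_smul, ← map_smul, ← map_add] at parts
  set y := ∫ r in Ioi (0 : ℝ), gaussKernel p t r • g r
  set w := p • (∫ r in Ioi (0 : ℝ), gaussKernel (p - 1) t r • g r) +
        (t ^ 2 / 4 : ℂ) • ∫ r in Ioi (0 : ℝ), gaussKernel (p - 2) t r • g r
  have hy : R (y + w) = y := by
    rw [map_add, ← sub_eq_zero, ← parts]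
    abel
  obtain ⟨h, hA⟩ := hR (y + w)
  simp only [hy] at h hA
  exact ⟨h, add_right_cancel (hA.trans (add_comm y w))⟩

/-- The radial operator `u'' + ((1 - 2α) / t) u'` applied to `t ↦ c (t / 2) ^ (2α) F(t)`. -/
theorem deriv_deriv_add_smul_deriv_eq {X : Type*} [NormedAddCommGroup X] [NormedSpace ℂ X]
    {α c : ℂ} (hα : α ≠ 0) {u F F' F'' : ℝ → X}
    (hu : ∀ t : ℝ, 0 < t → u t = c • (((t : ℂ) / 2) ^ (2 * α)) • F t)
    (hF : ∀ t, 0 < t → HasDerivAt F (F' t) t) (hF' : ∀ t, 0 < t → HasDerivAt F' (F'' t) t)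
    {t : ℝ} (ht : 0 < t) :
    deriv (deriv u) t + ((1 - 2 * α) / (t : ℂ)) • deriv u t =
      c • (((t : ℂ) / 2) ^ (2 * α)) • (F'' t + ((1 + 2 * α) / (t : ℂ)) • F' t) := by
  have hpow : ∀ s : ℝ, 0 < s → HasDerivAt (fun s : ℝ => ((s : ℂ) / 2) ^ (2 * α))
      (((s : ℂ) / 2) ^ (2 * α) * (2 * α / s)) s := by
    intro s hs
    have h := (hasDerivAt_ofReal_cpow_const (x := s / 2) (r := 2 * α) (by positivity)
      (by simpa using hα)).scomp s ((hasDerivAt_id s).div_const 2)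
    have hs' : (s : ℂ) ≠ 0 := by exact_mod_cast hs.ne'
    convert! h using 1
    · ext r; simp
    · push_cast
      rw [Complex.cpow_sub _ _ (by simpa using hs'), Complex.cpow_one, Complex.real_smul]
      push_cast
      field_simp
  have hinv : ∀ s : ℝ, 0 < s → HasDerivAt (fun s : ℝ => 2 * α / (s : ℂ))
      (-(2 * α) / (s : ℂ) ^ 2) s := by
    intro s hs
    have hs' : (s : ℂ) ≠ 0 := by exact_mod_cast hs.ne'
    convert! ((hasDerivAt_id s).ofReal_comp.inv hs').const_mul (2 * α) using 1
    simp only [id, Complex.ofReal_one]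
    ring
  have hu' : ∀ s : ℝ, 0 < s → HasDerivAt u
      (c • (((s : ℂ) / 2) ^ (2 * α)) • (F' s + (2 * α / (s : ℂ)) • F s)) s := by
    intro s hs
    have h := ((hpow s hs).smul (hF s hs)).const_smul c
    refine (h.congr_of_eventuallyEq ?_).congr_deriv ?_
    · filter_upwards [Ioi_mem_nhds hs] with r hr using hu r hr
    · simp only [smul_add, smul_smul]
  have hu'' : HasDerivAt (deriv u) _ t :=
    (((hpow t ht).smul ((hF' t ht).add ((hinv t ht).smul (hF t ht)))).const_smul
      c).congr_of_eventuallyEq (by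
        filter_upwards [Ioi_mem_nhds ht] with r hr using (hu' r hr).deriv)
  have ht' : (t : ℂ) ≠ 0 := by exact_mod_cast ht.ne'
  rw [hu''.deriv, (hu' t ht).deriv]
  simp only [Pi.add_apply, Pi.smul_apply']
  match_scalars <;> field_simp <;> ring

/-- `A` non-negative in a Banach space `X`, `-A_D` generating a bounded `C₀`-semigroup
`(T(t))` on `D := closure D(A)`.  For `x ∈ D(A)` the harmonic extension `u(t) = U(t)x`
satisfies `u(t) ∈ D(A)` and `u''(t) + ((1-2α)/t) u'(t) = A u(t)` for `t > 0`. -/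
theorem stmt8 {X : Type*} [NormedAddCommGroup X] [NormedSpace ℂ X] [CompleteSpace X]
    (A : X →ₗ.[ℂ] X) (R : ℝ → X →L[ℂ] X) (M : ℝ)
    (α : ℂ) (h0 : 0 < α.re) (h1 : α.re < 1)
    (hR : ∀ l : ℝ, 0 < l → ∀ y : X,
      ∃ h : R l y ∈ A.domain, A ⟨R l y, h⟩ + (l : ℂ) • R l y = y)
    (hRinv : ∀ l : ℝ, 0 < l → ∀ x : A.domain, R l (A x + (l : ℂ) • (x : X)) = x)
    (hM : ∀ l : ℝ, 0 < l → ‖(l : ℂ) • R l‖ ≤ M)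
    (T : ℝ → X →L[ℂ] X)
    (hTD : ∀ t : ℝ, 0 ≤ t → ∀ y ∈ closure (A.domain : Set X),
      T t y ∈ closure (A.domain : Set X))
    (hT0 : ∀ y ∈ closure (A.domain : Set X), T 0 y = y)
    (hsemi : ∀ s t : ℝ, 0 ≤ s → 0 ≤ t → ∀ y ∈ closure (A.domain : Set X),
      T (s + t) y = T s (T t y))
    (hcont : ∀ y ∈ closure (A.domain : Set X), ContinuousOn (fun t => T t y) (Ici 0))
    (hbdd : ∀ t : ℝ, 0 ≤ t → ∀ y ∈ closure (A.domain : Set X), ‖T t y‖ ≤ M * ‖y‖)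
    (hgen : ∀ x : A.domain, ∀ t : ℝ, 0 ≤ t →
      ∃ hm : T t (x : X) ∈ A.domain,
        HasDerivAt (fun s => T s (x : X)) (-(A ⟨T t (x : X), hm⟩)) t)
    (x : A.domain) (u : ℝ → X) (hu0 : u 0 = (x : X))
    (hut : ∀ t : ℝ, 0 < t → u t = (1 / Complex.Gamma α) •
      ((((t : ℂ) / 2) ^ (2 * α)) •
        ∫ r in Ioi (0:ℝ),
          (((r : ℂ) ^ (-α - 1)) * (Real.exp (-(t ^ 2) / (4 * r)) : ℂ)) • T r (x : X))) :
    ∀ t : ℝ, 0 < t → ∃ h : u t ∈ A.domain,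
      deriv (deriv u) t + ((1 - 2 * α) / (t : ℂ)) • deriv u t = A ⟨u t, h⟩ := by
  set I : ℂ → ℝ → X := fun p t => ∫ r in Ioi (0 : ℝ), gaussKernel p t r • T r (x : X)
  have hd : ∀ r : ℝ, 0 < r → ∃ h : T r (x : X) ∈ A.domain,
      HasDerivAt (fun s => T s (x : X)) (-(A ⟨T r (x : X), h⟩)) r := fun r hr => hgen x r hr.le
  have hg : ContinuousOn (fun r => T r (x : X)) (Ioi 0) := fun r hr =>
    (hd r hr).choose_spec.continuousAt.continuousWithinAt
  have hC : ∀ r : ℝ, 0 < r → ‖T r (x : X)‖ ≤ M * ‖(x : X)‖ := fun r hr =>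
    hbdd r hr.le _ (subset_closure x.2)
  have hp : (-α - 1).re < -1 := by simp; linarith
  have hF : ∀ t : ℝ, 0 < t → HasDerivAt (I (-α - 1)) (-(t / 2 : ℂ) • I (-α - 1 - 1) t) t :=
    fun t ht => hasDerivAt_integral_gaussKernel_smul hg hC hp ht
  have hF' : ∀ t : ℝ, 0 < t → HasDerivAt (fun s : ℝ => -(s / 2 : ℂ) • I (-α - 1 - 1) s)
      (-(t / 2 : ℂ) • -(t / 2 : ℂ) • I (-α - 1 - 1 - 1) t + -(1 / 2 : ℂ) • I (-α - 1 - 1) t)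
      t := by
    intro t ht
    have h : HasDerivAt (fun s : ℝ => -(s / 2 : ℂ)) (-(1 / 2 : ℂ)) t := by
      simpa using ((hasDerivAt_id t).ofReal_comp.div_const 2).fun_neg
    exact h.smul (hasDerivAt_integral_gaussKernel_smul hg hC (by simp; linarith) ht)
  intro t ht
  obtain ⟨h, hA⟩ := integral_gaussKernel_smul_mem_domain A (R 1)
    (by simpa using hR 1 one_pos) (by simpa using hRinv 1 one_pos) hC hd hp ht
  have hu : ∀ t : ℝ, 0 < t → u t = (1 / Complex.Gamma α) •
      (((t : ℂ) / 2) ^ (2 * α)) • I (-α - 1) t := hut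
  have hmem : u t ∈ A.domain := by
    rw [hu t ht]
    exact A.domain.smul_mem _ (A.domain.smul_mem _ h)
  refine ⟨hmem, ?_⟩
  have hα : α ≠ 0 := by rintro rfl; simp at h0
  have hAu : A ⟨u t, hmem⟩ = (1 / Complex.Gamma α) • (((t : ℂ) / 2) ^ (2 * α)) •
      A ⟨I (-α - 1) t, h⟩ := by
    rw [← A.map_smul, ← A.map_smul]
    congr 1
    exact Subtype.ext (hu t ht)
  rw [deriv_deriv_add_smul_deriv_eq hα hu hF hF' ht, hAu, hA]
  have ht' : (t : ℂ) ≠ 0 := by exact_mod_cast ht.ne'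
  rw [show -α - 1 - 2 = -α - 1 - 1 - 1 by ring]
  congr 2
  match_scalars <;> field_simp <;> ring
end

section
/- Let A be non-negative in X with D = closure(D(A)), -A_D generating a bounded C₀-semigroup (T(t)) on D, α ∈ ℂ with 0 < Re α < 1, and c_α := Γ(1-α)/(2^{2α-1}Γ(α)). Then for every x ∈ D(A), with u(t) := U(t)x one has lim_{t→0+} (−t^{1-2α} u'(t)) = c_α J^α_A x, where J^α_A x = (sin(απ)/π) ∫_0^∞ t^{α-1}(t+A)^{-1}Ax dt. -/
open MeasureTheory Set Filter Topology

section ExponentialWeight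

variable {E : Type*} [NormedAddCommGroup E] [NormedSpace ℝ E]

theorem exp_neg_sq_div_le_one (t : ℝ) {r : ℝ} (hr : 0 < r) :
    Real.exp (-(t ^ 2) / (4 * r)) ≤ 1 := by
  rw [Real.exp_le_one_iff, neg_div]
  exact neg_nonpos.mpr (by positivity)

theorem sq_div_mul_exp_neg_sq_div_le (t r : ℝ) :
    t ^ 2 / (4 * r) * Real.exp (-(t ^ 2) / (4 * r)) ≤ 1 := by
  rw [neg_div, Real.exp_neg, ← div_eq_mul_inv, div_le_one (Real.exp_pos _)]
  linarith [Real.add_one_le_exp (t ^ 2 / (4 * r))]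

theorem integrable_exp_smul {w : ℝ → E} (hw : IntegrableOn w (Ioi 0)) (t : ℝ) :
    IntegrableOn (fun r => Real.exp (-(t ^ 2) / (4 * r)) • w r) (Ioi 0) := by
  refine Integrable.bdd_smul hw 1 (Measurable.aestronglyMeasurable (by fun_prop)) ?_
  filter_upwards [ae_restrict_mem measurableSet_Ioi] with r hr
  rw [Real.norm_of_nonneg (Real.exp_pos _).le]
  exact exp_neg_sq_div_le_one t hr

theorem hasDerivAt_integral_exp_smul {w : ℝ → E} (hw : IntegrableOn w (Ioi 0)) {t : ℝ}
    (ht : 0 < t) :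
    HasDerivAt (fun s : ℝ => ∫ r in Ioi (0:ℝ), Real.exp (-(s ^ 2) / (4 * r)) • w r)
      (∫ r in Ioi (0:ℝ), (-(2 * t / (4 * r)) * Real.exp (-(t ^ 2) / (4 * r))) • w r) t := by
  refine (hasDerivAt_integral_of_dominated_loc_of_deriv_le (𝕜 := ℝ) (s := Ioi (t / 2))
    (bound := fun r => 4 / t * ‖w r‖)
    (F := fun s r => Real.exp (-(s ^ 2) / (4 * r)) • w r)
    (F' := fun s r => (-(2 * s / (4 * r)) * Real.exp (-(s ^ 2) / (4 * r))) • w r)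
    (Ioi_mem_nhds (by linarith)) ?_ (integrable_exp_smul hw t) ?_ ?_ ?_ ?_).2
  · exact Eventually.of_forall fun s => (integrable_exp_smul hw s).aestronglyMeasurable
  · exact AEStronglyMeasurable.smul
      (Measurable.aestronglyMeasurable (by fun_prop)) hw.aestronglyMeasurable
  · filter_upwards [ae_restrict_mem measurableSet_Ioi] with r hr s hs
    have hr : 0 < r := hr
    have hs : t / 2 < s := hs
    have hs0 : 0 < s := by linarith
    rw [norm_smul]
    gcongr
    rw [norm_mul, norm_neg, Real.norm_of_nonneg (by positivity),
      Real.norm_of_nonneg (Real.exp_pos _).le]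
    calc 2 * s / (4 * r) * Real.exp (-(s ^ 2) / (4 * r))
        = 2 / s * (s ^ 2 / (4 * r) * Real.exp (-(s ^ 2) / (4 * r))) := by field_simp
      _ ≤ 2 / s * 1 := by gcongr; exact sq_div_mul_exp_neg_sq_div_le s r
      _ ≤ 4 / t := by
        rw [mul_one, div_le_div_iff₀ hs0 ht]; linarith
  · exact hw.norm.const_mul _
  · filter_upwards with r s _
    have h : HasDerivAt (fun y : ℝ => -(y ^ 2) / (4 * r)) (-(2 * s / (4 * r))) s := by
      have := (hasDerivAt_pow 2 s).neg.div_const (4 * r)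
      simpa [neg_div] using this
    have h' := h.exp.smul_const (w r)
    rwa [mul_comm (Real.exp _)] at h'

theorem tendsto_integral_exp_smul {w : ℝ → E} (hw : IntegrableOn w (Ioi 0)) :
    Tendsto (fun s : ℝ => ∫ r in Ioi (0:ℝ), Real.exp (-(s ^ 2) / (4 * r)) • w r)
      (𝓝[>] 0) (𝓝 (∫ r in Ioi (0:ℝ), w r)) := by
  refine tendsto_integral_filter_of_dominated_convergence (fun r => ‖w r‖)
    (Eventually.of_forall fun s => (integrable_exp_smul hw s).aestronglyMeasurable)
    (Eventually.of_forall fun s => ?_) hw.norm (Eventually.of_forall fun r => ?_)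
  · filter_upwards [ae_restrict_mem measurableSet_Ioi] with r hr
    rw [norm_smul, Real.norm_of_nonneg (Real.exp_pos _).le]
    exact mul_le_of_le_one_left (norm_nonneg _) (exp_neg_sq_div_le_one s hr)
  · have h : Continuous fun s : ℝ => Real.exp (-(s ^ 2) / (4 * r)) • w r := by fun_prop
    simpa using (h.tendsto 0).mono_left nhdsWithin_le_nhds

theorem tendsto_smul_integral_deriv_exp_smul {w : ℝ → E} (hw : IntegrableOn w (Ioi 0)) :
    Tendsto (fun s : ℝ => s • ∫ r in Ioi (0:ℝ),
        (-(2 * s / (4 * r)) * Real.exp (-(s ^ 2) / (4 * r))) • w r)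
      (𝓝[>] 0) (𝓝 0) := by
  simp_rw [← integral_smul, smul_smul]
  rw [← integral_zero ℝ E (μ := volume.restrict (Ioi 0))]
  refine tendsto_integral_filter_of_dominated_convergence (fun r => 2 * ‖w r‖)
    (Eventually.of_forall fun s => AEStronglyMeasurable.smul
      (Measurable.aestronglyMeasurable (by fun_prop))
      hw.aestronglyMeasurable)
    (Eventually.of_forall fun s => ?_) (hw.norm.const_mul _) ?_
  · filter_upwards [ae_restrict_mem measurableSet_Ioi] with r hr
    have hr : 0 < r := hr
    rw [norm_smul]
    gcongr
    have : s * (-(2 * s / (4 * r)) * Real.exp (-(s ^ 2) / (4 * r))) =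
        -(2 * (s ^ 2 / (4 * r) * Real.exp (-(s ^ 2) / (4 * r)))) := by ring
    rw [this, norm_neg, Real.norm_of_nonneg (by positivity)]
    linarith [sq_div_mul_exp_neg_sq_div_le s r]
  · filter_upwards [ae_restrict_mem measurableSet_Ioi] with r hr
    have h : Continuous fun s : ℝ =>
        (s * (-(2 * s / (4 * r)) * Real.exp (-(s ^ 2) / (4 * r)))) • w r := by fun_prop
    simpa using (h.tendsto 0).mono_left nhdsWithin_le_nhds

end ExponentialWeight

theorem tendsto_cpow_smul_deriv {X : Type*} [NormedAddCommGroup X] [NormedSpace ℂ X]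
    {w : ℝ → X} (hw : IntegrableOn w (Ioi 0)) {α : ℂ} (c : ℂ) (x : X) {u : ℝ → X}
    (hu : ∀ t : ℝ, 0 < t → u t = x + (c * (t : ℂ) ^ (2 * α)) •
      ∫ r in Ioi (0:ℝ), Real.exp (-(t ^ 2) / (4 * r)) • w r) :
    Tendsto (fun t : ℝ => ((t : ℂ) ^ ((1 : ℂ) - 2 * α)) • deriv u t) (𝓝[>] (0:ℝ))
      (𝓝 ((c * (2 * α)) • ∫ r in Ioi (0:ℝ), w r)) := by
  have hlim := ((tendsto_integral_exp_smul hw).const_smul (c * (2 * α))).add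
    ((tendsto_smul_integral_deriv_exp_smul hw).const_smul c)
  rw [smul_zero, add_zero] at hlim
  refine hlim.congr' ?_
  filter_upwards [self_mem_nhdsWithin] with t ht
  have ht : 0 < t := ht
  have htC : (t : ℂ) ≠ 0 := by exact_mod_cast ht.ne'
  have hpow : HasDerivAt (fun s : ℝ => (s : ℂ) ^ (2 * α)) (2 * α * (t : ℂ) ^ (2 * α - 1)) t := by
    have := (hasDerivAt_id (t : ℂ)).cpow_const (c := 2 * α) (Or.inl (by simpa using ht))
    simpa using this.comp_ofReal
  have hd := ((hpow.const_mul c).smul (hasDerivAt_integral_exp_smul hw ht)).const_add x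
  have hd' : HasDerivAt u _ t := hd.congr_of_eventuallyEq
    ((eventually_gt_nhds ht).mono fun s hs => hu s hs)
  rw [hd'.deriv, smul_add, smul_smul, smul_smul, add_comm, ← Complex.coe_smul, smul_smul]
  have e1 : (t : ℂ) ^ ((1 : ℂ) - 2 * α) * (c * (t : ℂ) ^ (2 * α)) = c * t := by
    rw [mul_left_comm, ← Complex.cpow_add _ _ htC]; simp
  have e2 : (t : ℂ) ^ ((1 : ℂ) - 2 * α) * (c * (2 * α * (t : ℂ) ^ (2 * α - 1))) =
      c * (2 * α) := by
    have : (t : ℂ) ^ ((1 : ℂ) - 2 * α) * (t : ℂ) ^ (2 * α - 1) = 1 := by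
      rw [← Complex.cpow_add _ _ htC]; simp
    linear_combination c * (2 * α) * this
  rw [e1, e2]

theorem integral_cpow_mul_exp_neg_sq_div {α : ℂ} (h0 : 0 < α.re) {t : ℝ} (ht : 0 < t) :
    ∫ r in Ioi (0:ℝ), (r : ℂ) ^ (-α - 1) * (Real.exp (-(t ^ 2) / (4 * r)) : ℂ) =
      (((t : ℂ) / 2) ^ (2 * α))⁻¹ * Complex.Gamma α := by
  have h := Complex.integral_cpow_mul_exp_neg_mul_Ioi h0 (r := t ^ 2 / 4) (by positivity)
  rw [← integral_comp_rpow_Ioi _ (neg_ne_zero.mpr one_ne_zero)] at h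
  have e : (1 / ((t ^ 2 / 4 : ℝ) : ℂ)) ^ α = (((t : ℂ) / 2) ^ (2 * α))⁻¹ := by
    have h2 : (t : ℂ) / 2 = ((t / 2 : ℝ) : ℂ) := by push_cast; ring
    have h4 : 1 / ((t ^ 2 / 4 : ℝ) : ℂ) = (((t / 2) ^ 2 : ℝ) : ℂ)⁻¹ := by push_cast; ring
    have hp : (0:ℝ) < t / 2 := by positivity
    have hpC : ((t / 2 : ℝ) : ℂ) ≠ 0 := by exact_mod_cast hp.ne'
    rw [h4, h2, ← Complex.ofReal_inv, ← Complex.cpow_neg,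
      Complex.cpow_def_of_ne_zero (by exact_mod_cast (by positivity : ((t / 2) ^ 2)⁻¹ ≠ 0)),
      Complex.cpow_def_of_ne_zero hpC, ← Complex.ofReal_log (by positivity),
      ← Complex.ofReal_log hp.le, Real.log_inv, Real.log_pow]
    congr 1
    push_cast
    ring
  rw [← e, ← h]
  refine setIntegral_congr_fun measurableSet_Ioi fun r hr => ?_
  have hr : 0 < r := hr
  have hrC : (r : ℂ) ≠ 0 := by exact_mod_cast hr.ne'
  have e1 : (r : ℂ) ^ (-α - 1) =
      ((r ^ (-1 - 1 : ℝ) : ℝ) : ℂ) * ((r ^ (-1:ℝ) : ℝ) : ℂ) ^ (α - 1) := by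
    rw [Complex.ofReal_cpow hr.le, Complex.cpow_def_of_ne_zero
      (x := ((r ^ (-1:ℝ) : ℝ) : ℂ)) (Complex.ofReal_ne_zero.mpr (Real.rpow_pos_of_pos hr _).ne'),
      ← Complex.ofReal_log (Real.rpow_pos_of_pos hr _).le, Real.log_rpow hr,
      Complex.cpow_def_of_ne_zero hrC, Complex.cpow_def_of_ne_zero hrC,
      ← Complex.ofReal_log hr.le, ← Complex.exp_add]
    congr 1
    push_cast
    ring
  have e2 : -(t ^ 2) / (4 * r) = -(t ^ 2 / 4 * r ^ (-1:ℝ)) := by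
    rw [Real.rpow_neg_one]; field_simp
  simp only [abs_neg, abs_one, one_mul]
  rw [e1, e2, Complex.real_smul, mul_assoc]
  push_cast
  rfl

section Fractional

variable {X : Type*} [NormedAddCommGroup X] [NormedSpace ℂ X]

theorem integrableOn_cpow_smul_of_le {g : ℝ → X} {α : ℂ} (h0 : 0 < α.re) (h1 : α.re < 1)
    (hg : AEStronglyMeasurable g (volume.restrict (Ioi 0))) {B C : ℝ}
    (hB : ∀ r : ℝ, 0 < r → ‖g r‖ ≤ B) (hC : ∀ r : ℝ, 0 < r → ‖g r‖ ≤ C * r) :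
    IntegrableOn (fun r : ℝ => (r : ℂ) ^ (-α - 1) • g r) (Ioi 0) := by
  have hmeas : AEStronglyMeasurable (fun r : ℝ => (r : ℂ) ^ (-α - 1) • g r)
      (volume.restrict (Ioi 0)) :=
    AEStronglyMeasurable.smul (Measurable.aestronglyMeasurable (by fun_prop)) hg
  have hnorm : ∀ r : ℝ, 0 < r → ‖(r : ℂ) ^ (-α - 1) • g r‖ = r ^ (-α.re - 1) * ‖g r‖ := by
    intro r hr
    rw [norm_smul, Complex.norm_cpow_eq_rpow_re_of_pos hr]
    simp
  rw [← Ioc_union_Ioi_eq_Ioi zero_le_one]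
  refine IntegrableOn.union ?_ ?_
  · have hi : IntegrableOn (fun r : ℝ => C * r ^ (-α.re)) (Ioc 0 1) :=
      ((intervalIntegrable_iff_integrableOn_Ioc_of_le zero_le_one).mp
        (intervalIntegral.intervalIntegrable_rpow' (by linarith))).const_mul C
    refine Integrable.mono' hi
      (hmeas.mono_measure (Measure.restrict_mono Ioc_subset_Ioi_self le_rfl)) ?_
    filter_upwards [ae_restrict_mem measurableSet_Ioc] with r hr
    rw [hnorm r hr.1]
    calc r ^ (-α.re - 1) * ‖g r‖ ≤ r ^ (-α.re - 1) * (C * r) :=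
          mul_le_mul_of_nonneg_left (hC r hr.1) (Real.rpow_nonneg hr.1.le _)
      _ = C * r ^ (-α.re) := by
          rw [Real.rpow_sub_one hr.1.ne']
          field_simp [hr.1.ne']
  · have hi : IntegrableOn (fun r : ℝ => B * r ^ (-α.re - 1)) (Ioi 1) :=
      (integrableOn_Ioi_rpow_of_lt (by linarith) zero_lt_one).const_mul B
    refine Integrable.mono' hi
      (hmeas.mono_measure (Measure.restrict_mono (Ioi_subset_Ioi zero_le_one) le_rfl)) ?_
    filter_upwards [ae_restrict_mem measurableSet_Ioi] with r hr
    have hr0 : 0 < r := zero_lt_one.trans hr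
    rw [hnorm r hr0, mul_comm]
    exact mul_le_mul_of_nonneg_right (hB r hr0) (Real.rpow_nonneg hr0.le _)

theorem integral_integral_cpow_mul_exp_smul [CompleteSpace X] {g : ℝ → X} {α : ℂ} (h0 : 0 < α.re)
    (hg : AEStronglyMeasurable g (volume.restrict (Ioi 0)))
    (hw : IntegrableOn (fun r : ℝ => (r : ℂ) ^ (-α - 1) • g r) (Ioi 0)) :
    ∫ s in Ioi (0:ℝ), ∫ r in Ioi (0:ℝ), ((s : ℂ) ^ α * Complex.exp (-(r * s))) • g r =
      Complex.Gamma (α + 1) • ∫ r in Ioi (0:ℝ), (r : ℂ) ^ (-α - 1) • g r := by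
  have h1 : 0 < (α + 1).re := by simp; linarith
  have hinner : ∀ r : ℝ, 0 < r →
      ∫ s in Ioi (0:ℝ), (s : ℂ) ^ α * Complex.exp (-(r * s)) =
        Complex.Gamma (α + 1) * (r : ℂ) ^ (-α - 1) := by
    intro r hr
    have h := Complex.integral_cpow_mul_exp_neg_mul_Ioi h1 hr
    rw [add_sub_cancel_right] at h
    rw [h, mul_comm, one_div, ← Complex.ofReal_inv, ← neg_add', Complex.cpow_neg,
      Complex.ofReal_inv, Complex.inv_cpow]
    rw [Complex.arg_ofReal_of_nonneg hr.le]
    exact Real.pi_pos.ne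
  have hnorm : ∀ r s : ℝ, 0 < s → ‖((s : ℂ) ^ α * Complex.exp (-(r * s))) • g r‖ =
      s ^ (α.re + 1 - 1) * Real.exp (-(r * s)) * ‖g r‖ := by
    intro r s hs
    rw [norm_smul, norm_mul, Complex.norm_cpow_eq_rpow_re_of_pos hs, Complex.norm_exp]
    simp
  have hint : Integrable (Function.uncurry fun s r : ℝ =>
      ((s : ℂ) ^ α * Complex.exp (-(r * s))) • g r)
      ((volume.restrict (Ioi (0:ℝ))).prod (volume.restrict (Ioi (0:ℝ)))) := by
    rw [integrable_prod_iff']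
    · constructor
      · filter_upwards [ae_restrict_mem measurableSet_Ioi] with r hr
        suffices h : Integrable (fun s : ℝ => (s : ℂ) ^ α * Complex.exp (-(r * s)))
            (volume.restrict (Ioi 0)) from h.smul_const (g r)
        by_contra hc
        have := hinner r hr
        rw [integral_undef hc] at this
        have hrC : (r : ℂ) ≠ 0 := by exact_mod_cast (ne_of_gt hr)
        exact mul_ne_zero (Complex.Gamma_ne_zero_of_re_pos h1)
          ((Complex.cpow_ne_zero_iff_of_exponent_ne_zero
            (fun h => by have := congrArg Complex.re h; simp at this; linarith)).mpr hrC) this.symm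
      · refine (hw.norm.const_mul (Real.Gamma (α.re + 1))).congr ?_
        filter_upwards [ae_restrict_mem measurableSet_Ioi] with r hr
        have hr : 0 < r := hr
        simp only [Function.uncurry]
        rw [setIntegral_congr_fun measurableSet_Ioi fun s hs => hnorm r s hs,
          integral_mul_const, Real.integral_rpow_mul_exp_neg_mul_Ioi (by linarith) hr,
          norm_smul, Complex.norm_cpow_eq_rpow_re_of_pos hr, one_div, ← Real.rpow_neg_eq_inv_rpow]
        simp only [Complex.sub_re, Complex.neg_re, Complex.one_re, neg_add']
        ring
    · refine AEStronglyMeasurable.smul (Measurable.aestronglyMeasurable (by fun_prop)) ?_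
      exact hg.comp_snd
  rw [integral_integral_swap hint, ← integral_smul]
  refine setIntegral_congr_fun measurableSet_Ioi fun r hr => ?_
  rw [integral_smul_const, hinner r hr, mul_smul]

end Fractional

section Semigroup

variable {X : Type*} [NormedAddCommGroup X] [NormedSpace ℂ X]

theorem mem_closure_of_hasDerivAt_zero {D : Submodule ℂ X} {f : ℝ → X} {y : X}
    (hf : HasDerivAt f y 0) (hmem : ∀ t : ℝ, 0 ≤ t → f t ∈ closure (D : Set X)) :
    y ∈ closure (D : Set X) := by
  have h := (hasDerivWithinAt_iff_tendsto_slope' self_notMem_Ioi).mp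
    (hf.hasDerivWithinAt (s := Ioi 0))
  refine isClosed_closure.mem_of_tendsto h ?_
  filter_upwards [self_mem_nhdsWithin] with t ht
  have ht : 0 < t := ht
  rw [← Submodule.topologicalClosure_coe] at hmem ⊢
  rw [slope_def_module, ← Complex.coe_smul]
  exact Submodule.smul_mem _ _ (Submodule.sub_mem _ (hmem t ht.le) (hmem 0 le_rfl))

theorem resolvent_eq_integral [CompleteSpace X] (A : X →ₗ.[ℂ] X) (S : X →L[ℂ] X) {l B : ℝ}
    (hl : 0 < l) (hS : ∀ x : A.domain, S (A x + (l : ℂ) • (x : X)) = x)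
    (x : A.domain) {f : ℝ → X} (hf0 : f 0 = x) (hB : ∀ t : ℝ, 0 ≤ t → ‖f t‖ ≤ B)
    (hf : ∀ t : ℝ, 0 ≤ t → ∃ hm : f t ∈ A.domain, HasDerivAt f (-(A ⟨f t, hm⟩)) t) :
    S (A x) = ∫ r in Ioi (0:ℝ), (l * Real.exp (-(r * l))) • ((x : X) - f r) := by
  have hexp : ∀ r : ℝ, HasDerivAt (fun r : ℝ => Real.exp (-(r * l))) (-l * Real.exp (-(r * l))) r := by
    intro r
    have := ((hasDerivAt_id r).mul_const l).neg.exp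
    simpa [mul_comm] using this
  have hd : ∀ r : ℝ, 0 ≤ r →
      HasDerivAt (fun r => Real.exp (-(r * l)) • (l • S (f r) - (x : X)))
        ((l * Real.exp (-(r * l))) • ((x : X) - f r)) r := by
    intro r hr
    obtain ⟨hm, hder⟩ := hf r hr
    have h1 : HasDerivAt (fun r => S (f r)) (S (-(A ⟨f r, hm⟩))) r :=
      (S.restrictScalars ℝ).hasFDerivAt.comp_hasDerivAt r hder
    have h2 : S (-(A ⟨f r, hm⟩)) = l • S (f r) - f r := by
      have := hS ⟨f r, hm⟩
      rw [map_add, map_smul, Complex.coe_smul] at this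
      rw [map_neg, ← sub_eq_zero, ← sub_eq_zero.mpr this.symm]
      abel
    rw [h2] at h1
    have h3 := (hexp r).smul ((h1.const_smul l).sub_const (x : X))
    refine h3.congr_deriv ?_
    simp only [Pi.smul_apply]
    module
  have hcont : ContinuousOn f (Ici 0) := fun r hr =>
    ((hf r hr).choose_spec.continuousAt).continuousWithinAt
  have hexpi : IntegrableOn (fun r : ℝ => l * Real.exp (-(r * l))) (Ioi 0) := by
    have := (exp_neg_integrableOn_Ioi 0 hl).const_mul l
    simpa [mul_comm, IntegrableOn] using this
  have hint : IntegrableOn (fun r : ℝ => (l * Real.exp (-(r * l))) • ((x : X) - f r)) (Ioi 0) := by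
    refine Integrable.smul_bdd (𝕜 := ℝ) hexpi (‖(x : X)‖ + B) ?_ ?_
    · exact ((continuousOn_const.sub hcont).mono Ioi_subset_Ici_self).aestronglyMeasurable
        measurableSet_Ioi
    · filter_upwards [ae_restrict_mem measurableSet_Ioi] with r hr
      exact (norm_sub_le _ _).trans (add_le_add_right (hB r (le_of_lt hr)) _)
  have hlim : Tendsto (fun r => Real.exp (-(r * l)) • (l • S (f r) - (x : X))) atTop (𝓝 0) := by
    have he : Tendsto (fun r : ℝ => Real.exp (-(r * l))) atTop (𝓝 0) :=
      Real.tendsto_exp_neg_atTop_nhds_zero.comp (tendsto_id.atTop_mul_const hl)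
    refine squeeze_zero_norm' (a := fun r => Real.exp (-(r * l)) * (l * (‖S‖ * B) + ‖(x : X)‖))
      ?_ (by simpa using he.mul_const (l * (‖S‖ * B) + ‖(x : X)‖))
    filter_upwards [eventually_ge_atTop 0] with r hr
    rw [norm_smul, Real.norm_of_nonneg (Real.exp_pos _).le]
    gcongr
    refine (norm_sub_le _ _).trans ?_
    rw [norm_smul, Real.norm_of_nonneg hl.le]
    gcongr
    exact S.le_opNorm_of_le (hB r hr)
  rw [integral_Ioi_of_hasDerivAt_of_tendsto (hd 0 le_rfl).continuousAt.continuousWithinAt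
    (fun r hr => hd r (le_of_lt hr)) hint hlim, hf0]
  have := hS x
  rw [map_add, map_smul, Complex.coe_smul] at this
  rw [zero_mul, neg_zero, Real.exp_zero, one_smul, zero_sub, neg_sub]
  exact eq_sub_of_add_eq this

theorem norm_sub_le_of_semigroup (A : X →ₗ.[ℂ] X) (M : ℝ) (T : ℝ → X →L[ℂ] X)
    (hTD : ∀ t : ℝ, 0 ≤ t → ∀ y ∈ closure (A.domain : Set X),
      T t y ∈ closure (A.domain : Set X))
    (hT0 : ∀ y ∈ closure (A.domain : Set X), T 0 y = y)
    (hsemi : ∀ s t : ℝ, 0 ≤ s → 0 ≤ t → ∀ y ∈ closure (A.domain : Set X),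
      T (s + t) y = T s (T t y))
    (hbdd : ∀ t : ℝ, 0 ≤ t → ∀ y ∈ closure (A.domain : Set X), ‖T t y‖ ≤ M * ‖y‖)
    (hgen : ∀ x : A.domain, ∀ t : ℝ, 0 ≤ t →
      ∃ hm : T t (x : X) ∈ A.domain,
        HasDerivAt (fun s => T s (x : X)) (-(A ⟨T t (x : X), hm⟩)) t)
    (x : A.domain) {t : ℝ} (ht : 0 ≤ t) : ‖(x : X) - T t x‖ ≤ M * ‖A x‖ * t := by
  have hxD : (x : X) ∈ closure (A.domain : Set X) := subset_closure x.2
  have hder0 : HasDerivAt (fun s => T s (x : X)) (-(A x)) 0 := by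
    obtain ⟨hm, h⟩ := hgen x 0 le_rfl
    have : (⟨T 0 (x : X), hm⟩ : A.domain) = x := Subtype.ext (hT0 _ hxD)
    rwa [this] at h
  have hAx : -(A x) ∈ closure (A.domain : Set X) :=
    mem_closure_of_hasDerivAt_zero hder0 fun s hs => hTD s hs _ hxD
  have hder : ∀ r ∈ Ici (0:ℝ), HasDerivWithinAt (fun s => T s (x : X)) (T r (-(A x))) (Ici 0) r := by
    intro r hr
    have hr : 0 ≤ r := hr
    obtain ⟨hm, h⟩ := hgen x r hr
    suffices T r (-(A x)) = -(A ⟨T r (x : X), hm⟩) by rw [this]; exact h.hasDerivWithinAt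
    have ha : HasDerivWithinAt (fun s => T r (T s (x : X))) (T r (-(A x))) (Ici 0) 0 :=
      (((T r).restrictScalars ℝ).hasFDerivAt.comp_hasDerivAt 0 hder0).hasDerivWithinAt
    have hb : HasDerivWithinAt (fun s => T (r + s) (x : X)) (-(A ⟨T r (x : X), hm⟩)) (Ici 0) 0 := by
      have h' : HasDerivAt (fun s => T s (x : X)) (-(A ⟨T r (x : X), hm⟩)) (r + 0) := by
        rwa [add_zero]
      exact (h'.comp_const_add r 0).hasDerivWithinAt
    have hb' := hb.congr (f₁ := fun s => T r (T s (x : X)))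
      (fun s hs => (hsemi r s hr hs _ hxD).symm) (hsemi r 0 hr le_rfl _ hxD).symm
    exact (uniqueDiffWithinAt_Ici 0).eq_deriv _ ha hb'
  have h := Convex.norm_image_sub_le_of_norm_hasDerivWithin_le hder
    (fun r hr => hbdd r hr _ hAx) (convex_Ici 0) self_mem_Ici ht
  rw [hT0 _ hxD, norm_neg, sub_zero, Real.norm_of_nonneg ht] at h
  rwa [norm_sub_rev]

end Semigroup

open MeasureTheory Set Filter Topology

/-- `A` non-negative in a Banach space `X`, `-A_D` generating a bounded `C₀`-semigroup
`(T(t))` on `D := closure D(A)`.  For `x ∈ D(A)` the harmonic extension `u(t) = U(t)x`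
satisfies `lim_{t→0+} (-t^{1-2α} u'(t)) = c_α J^α_A x` with
`c_α = Γ(1-α)/(2^{2α-1}Γ(α))` and `J^α_A x = (sin(απ)/π) ∫_0^∞ s^{α-1}(s+A)⁻¹Ax ds`. -/
theorem stmt10 {X : Type*} [NormedAddCommGroup X] [NormedSpace ℂ X] [CompleteSpace X]
    (A : X →ₗ.[ℂ] X) (R : ℝ → X →L[ℂ] X) (M : ℝ)
    (α : ℂ) (h0 : 0 < α.re) (h1 : α.re < 1)
    (hR : ∀ l : ℝ, 0 < l → ∀ y : X,
      ∃ h : R l y ∈ A.domain, A ⟨R l y, h⟩ + (l : ℂ) • R l y = y)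
    (hRinv : ∀ l : ℝ, 0 < l → ∀ x : A.domain, R l (A x + (l : ℂ) • (x : X)) = x)
    (hM : ∀ l : ℝ, 0 < l → ‖(l : ℂ) • R l‖ ≤ M)
    (T : ℝ → X →L[ℂ] X)
    (hTD : ∀ t : ℝ, 0 ≤ t → ∀ y ∈ closure (A.domain : Set X),
      T t y ∈ closure (A.domain : Set X))
    (hT0 : ∀ y ∈ closure (A.domain : Set X), T 0 y = y)
    (hsemi : ∀ s t : ℝ, 0 ≤ s → 0 ≤ t → ∀ y ∈ closure (A.domain : Set X),
      T (s + t) y = T s (T t y))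
    (hcont : ∀ y ∈ closure (A.domain : Set X), ContinuousOn (fun t => T t y) (Ici 0))
    (hbdd : ∀ t : ℝ, 0 ≤ t → ∀ y ∈ closure (A.domain : Set X), ‖T t y‖ ≤ M * ‖y‖)
    (hgen : ∀ x : A.domain, ∀ t : ℝ, 0 ≤ t →
      ∃ hm : T t (x : X) ∈ A.domain,
        HasDerivAt (fun s => T s (x : X)) (-(A ⟨T t (x : X), hm⟩)) t)
    (x : A.domain) (u : ℝ → X) (hu0 : u 0 = (x : X))
    (hut : ∀ t : ℝ, 0 < t → u t = (1 / Complex.Gamma α) •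
      ((((t : ℂ) / 2) ^ (2 * α)) •
        ∫ r in Ioi (0:ℝ),
          (((r : ℂ) ^ (-α - 1)) * (Real.exp (-(t ^ 2) / (4 * r)) : ℂ)) • T r (x : X))) :
    Tendsto (fun t : ℝ => -(((t : ℂ) ^ ((1 : ℂ) - 2 * α)) • deriv u t))
      (𝓝[>] (0:ℝ))
      (𝓝 ((Complex.Gamma (1 - α) / (2 ^ (2 * α - 1) * Complex.Gamma α)) •
        ((Complex.sin (α * Real.pi) / (Real.pi : ℂ)) •
          ∫ s in Ioi (0:ℝ), ((s : ℂ) ^ (α - 1)) • R s (A x)))) := by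
  set g : ℝ → X := fun r => (x : X) - T r x with hg_def
  have hxD : (x : X) ∈ closure (A.domain : Set X) := subset_closure x.2
  have hgmeas : AEStronglyMeasurable g (volume.restrict (Ioi 0)) :=
    ((continuousOn_const.sub (hcont _ hxD)).mono Ioi_subset_Ici_self).aestronglyMeasurable
      measurableSet_Ioi
  have hw : IntegrableOn (fun r : ℝ => (r : ℂ) ^ (-α - 1) • g r) (Ioi 0) :=
    integrableOn_cpow_smul_of_le h0 h1 hgmeas
      (fun r hr => (norm_sub_le _ _).trans (add_le_add_right (hbdd r hr.le _ hxD) ‖(x : X)‖))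
      (fun r hr => norm_sub_le_of_semigroup A M T hTD hT0 hsemi hbdd hgen x hr.le)
  have hres : ∀ s : ℝ, 0 < s → (s : ℂ) ^ (α - 1) • R s (A x) =
      ∫ r in Ioi (0:ℝ), ((s : ℂ) ^ α * Complex.exp (-(r * s))) • g r := by
    intro s hs
    have hsC : (s : ℂ) ≠ 0 := by exact_mod_cast hs.ne'
    rw [resolvent_eq_integral A (R s) hs (hRinv s hs) x (hT0 _ hxD)
      (fun t ht => hbdd t ht _ hxD) (hgen x), ← integral_smul]
    refine integral_congr_ae (Eventually.of_forall fun r => ?_)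
    simp only
    rw [← Complex.coe_smul, smul_smul, Complex.cpow_sub _ _ hsC, Complex.cpow_one]
    congr 1
    push_cast
    field_simp
  have hJ : ∫ s in Ioi (0:ℝ), ((s : ℂ) ^ (α - 1)) • R s (A x) =
      Complex.Gamma (α + 1) • ∫ r in Ioi (0:ℝ), (r : ℂ) ^ (-α - 1) • g r := by
    rw [setIntegral_congr_fun measurableSet_Ioi hres,
      integral_integral_cpow_mul_exp_smul h0 hgmeas hw]
  have hΓ : Complex.Gamma α ≠ 0 := Complex.Gamma_ne_zero_of_re_pos h0
  have hu : ∀ t : ℝ, 0 < t → u t = (x : X) +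
      (-(1 / (Complex.Gamma α * 2 ^ (2 * α))) * (t : ℂ) ^ (2 * α)) •
      ∫ r in Ioi (0:ℝ), Real.exp (-(t ^ 2) / (4 * r)) • ((r : ℂ) ^ (-α - 1) • g r) := by
    intro t ht
    have htC : (t : ℂ) / 2 ≠ 0 := by
      simpa using ht.ne'
    have hP : ((t : ℂ) / 2) ^ (2 * α) ≠ 0 := by
      rw [Complex.cpow_def_of_ne_zero htC]; exact Complex.exp_ne_zero _
    have hK := integral_cpow_mul_exp_neg_sq_div h0 ht
    have hKi : Integrable (fun r : ℝ => (r : ℂ) ^ (-α - 1) *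
        (Real.exp (-(t ^ 2) / (4 * r)) : ℂ)) (volume.restrict (Ioi 0)) := by
      by_contra hc
      rw [integral_undef hc] at hK
      exact mul_ne_zero (inv_ne_zero hP) hΓ hK.symm
    have hsplit : ∫ r in Ioi (0:ℝ),
        (((r : ℂ) ^ (-α - 1)) * (Real.exp (-(t ^ 2) / (4 * r)) : ℂ)) • T r (x : X) =
        ((((t : ℂ) / 2) ^ (2 * α))⁻¹ * Complex.Gamma α) • (x : X) -
        ∫ r in Ioi (0:ℝ), Real.exp (-(t ^ 2) / (4 * r)) • ((r : ℂ) ^ (-α - 1) • g r) := by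
      rw [← hK, ← integral_smul_const, ← integral_sub (hKi.smul_const _)
        (integrable_exp_smul hw t)]
      refine integral_congr_ae (Eventually.of_forall fun r => ?_)
      simp only [hg_def]
      rw [← Complex.coe_smul]
      module
    have hPt : ((t : ℂ) / 2) ^ (2 * α) = (t : ℂ) ^ (2 * α) / 2 ^ (2 * α) := by
      have h2 : (t : ℂ) / 2 = (t : ℂ) * ((2⁻¹ : ℝ) : ℂ) := by push_cast; ring
      rw [h2, Complex.mul_cpow_ofReal_nonneg ht.le (by norm_num), Complex.ofReal_inv,
        Complex.inv_cpow _ _ (by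
          rw [Complex.arg_ofReal_of_nonneg (by norm_num)]; exact Real.pi_pos.ne)]
      simp [div_eq_mul_inv]
    rw [hut t ht, hsplit, smul_smul, smul_sub, smul_smul]
    have e1 : 1 / Complex.Gamma α * ((t : ℂ) / 2) ^ (2 * α) *
        ((((t : ℂ) / 2) ^ (2 * α))⁻¹ * Complex.Gamma α) = 1 := by
      field_simp
    rw [e1, one_smul, sub_eq_add_neg, ← neg_smul, hPt]
    congr 2
    field_simp
  have hlim := (tendsto_cpow_smul_deriv hw _ (x : X) hu).neg
  refine hlim.trans_eq (congrArg 𝓝 ?_)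
  rw [hJ, ← neg_smul, smul_smul, smul_smul]
  congr 1
  have hα : α ≠ 0 := fun h => by simp [h] at h0
  have hrefl := Complex.Gamma_mul_Gamma_one_sub α
  have hΓ1 : Complex.Gamma (1 - α) ≠ 0 := Complex.Gamma_ne_zero_of_re_pos (by simpa using h1)
  have hpi : (Real.pi : ℂ) ≠ 0 := by exact_mod_cast Real.pi_ne_zero
  have hsin : Complex.sin (Real.pi * α) ≠ 0 := by
    intro h
    rw [h, div_zero] at hrefl
    exact mul_ne_zero hΓ hΓ1 hrefl
  rw [eq_div_iff hsin] at hrefl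
  have h2 : (2 : ℂ) ^ (2 * α) ≠ 0 := by
    rw [Complex.cpow_def_of_ne_zero two_ne_zero]; exact Complex.exp_ne_zero _
  rw [mul_comm (Real.pi : ℂ) α] at hrefl hsin
  rw [Complex.Gamma_add_one α hα, Complex.cpow_sub _ _ two_ne_zero,
    Complex.cpow_one]
  field_simp
  linear_combination -hrefl
end

section
/- Define T_α on D(T_α) = {x ∈ D : lim_{t→0+} −t^{1-2α} U'(t)x exists} by T_α x = lim_{t→0+} −t^{1-2α}U'(t)x, where U(t)x is the harmonic-extension operator built from the semigroup generated by -A_D. Then T_α is closable. -/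
open MeasureTheory Set Filter Topology

/-- The kernel `r ^ (-α - 1) * exp (-s² / (4 r))` of the harmonic extension. -/
noncomputable def extensionKernel (α : ℂ) (s r : ℝ) : ℂ :=
  ((r : ℂ) ^ (-α - 1)) * (Real.exp (-(s ^ 2) / (4 * r)) : ℂ)

theorem integrableOn_rpow_neg_mul_exp_neg_div {q c : ℝ} (hq : 1 < q) (hc : 0 < c) :
    IntegrableOn (fun r : ℝ => r ^ (-q) * Real.exp (-c / r)) (Ioi 0) := by
  have h := (integrableOn_Ioi_comp_rpow_iff (fun x : ℝ => x ^ (q - 2) * Real.exp (-c * x ^ (1 : ℝ)))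
    (p := -1) (by norm_num)).2
    (integrableOn_rpow_mul_exp_neg_mul_rpow (by linarith) one_pos hc)
  refine h.congr_fun (fun r hr => ?_) measurableSet_Ioi
  have hr : 0 < r := hr
  simp only [smul_eq_mul, Real.rpow_one]
  rw [← Real.rpow_mul hr.le, abs_neg, abs_one, one_mul, ← mul_assoc, ← Real.rpow_add hr,
    Real.rpow_neg_one, div_eq_mul_inv]
  ring_nf

theorem norm_extensionKernel (α : ℂ) (s : ℝ) {r : ℝ} (hr : 0 < r) :
    ‖extensionKernel α s r‖ = r ^ (-(α.re + 1)) * Real.exp (-(s ^ 2 / 4) / r) := by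
  rw [extensionKernel, norm_mul, Complex.norm_cpow_eq_rpow_re_of_pos hr, Complex.norm_real,
    Real.norm_of_nonneg (Real.exp_pos _).le]
  congr 2
  · simp; ring
  · field_simp

theorem continuousOn_extensionKernel (α : ℂ) (s : ℝ) :
    ContinuousOn (extensionKernel α s) (Ioi 0) := by
  intro r hr
  have hr : 0 < r := hr
  refine ContinuousAt.continuousWithinAt (ContinuousAt.mul ?_ ?_)
  · exact Complex.continuousAt_ofReal_cpow_const r _ (Or.inr hr.ne')
  · refine Complex.continuous_ofReal.continuousAt.comp (Real.continuous_exp.continuousAt.comp ?_)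
    exact continuousAt_const.div (by fun_prop) (by positivity)

theorem norm_extensionKernel_le (α : ℂ) {d s : ℝ} (hd : 0 < d) (hs : d ≤ s) {r : ℝ} (hr : 0 < r) :
    ‖extensionKernel α s r‖ ≤ r ^ (-(α.re + 1)) * Real.exp (-(d ^ 2 / 4) / r) := by
  rw [norm_extensionKernel α s hr]
  gcongr

section Banach

variable {X : Type*} [NormedAddCommGroup X] [NormedSpace ℂ X]

theorem integrableOn_extensionKernel_smul {α : ℂ} (hα : 0 < α.re) {s : ℝ} (hs : 0 < s)
    {φ : ℝ → X} {B : ℝ} (hφ : ContinuousOn φ (Ioi 0)) (hB : ∀ r, 0 < r → ‖φ r‖ ≤ B) :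
    IntegrableOn (fun r => extensionKernel α s r • φ r) (Ioi 0) := by
  refine Integrable.mono' ((integrableOn_rpow_neg_mul_exp_neg_div (q := α.re + 1)
    (c := s ^ 2 / 4) (by linarith) (by positivity)).mul_const B)
    (((continuousOn_extensionKernel α s).smul hφ).aestronglyMeasurable measurableSet_Ioi) ?_
  refine (ae_restrict_iff' measurableSet_Ioi).2 (.of_forall fun r hr => ?_)
  rw [norm_smul]
  exact mul_le_mul (norm_extensionKernel_le α hs le_rfl hr) (hB r hr) (norm_nonneg _)
    (mul_nonneg (Real.rpow_nonneg (le_of_lt hr) _) (Real.exp_pos _).le)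

theorem hasDerivAt_extensionKernel (α : ℂ) (s : ℝ) {r : ℝ} (hr : 0 < r) :
    HasDerivAt (fun s => extensionKernel α s r) (-((s / 2 : ℝ) : ℂ) * extensionKernel (α + 1) s r)
      s := by
  have h1 : HasDerivAt (fun s : ℝ => Real.exp (-(s ^ 2) / (4 * r)))
      (Real.exp (-(s ^ 2) / (4 * r)) * (-(s / (2 * r)))) s := by
    refine (((hasDerivAt_pow 2 s).fun_neg.div_const (4 * r)).exp).congr_deriv ?_
    push_cast
    field_simp
    ring
  have h2 := (h1.ofReal_comp).const_mul ((r : ℂ) ^ (-α - 1))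
  refine h2.congr_deriv ?_
  have hr' : (r : ℂ) ≠ 0 := by exact_mod_cast hr.ne'
  have h3 : (r : ℂ) ^ (-(α + 1) - 1) = (r : ℂ) ^ (-α - 1) / r := by
    rw [show -(α + 1) - 1 = (-α - 1) - 1 by ring, Complex.cpow_sub _ _ hr', Complex.cpow_one]
  rw [extensionKernel, h3]
  push_cast
  field_simp

theorem hasDerivAt_integral_extensionKernel {α : ℂ} (hα : 0 < α.re) {t : ℝ} (ht : 0 < t)
    {φ : ℝ → X} {B : ℝ} (hφ : ContinuousOn φ (Ioi 0)) (hB : ∀ r, 0 < r → ‖φ r‖ ≤ B) :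
    HasDerivAt (fun s => ∫ r in Ioi (0 : ℝ), extensionKernel α s r • φ r)
      (-((t / 2 : ℝ) : ℂ) • ∫ r in Ioi (0 : ℝ), extensionKernel (α + 1) t r • φ r) t := by
  have hα1 : 0 < (α + 1).re := by simp; linarith
  have hB0 : 0 ≤ B := (norm_nonneg _).trans (hB 1 one_pos)
  have hmeas : ∀ (β : ℂ) (s : ℝ), AEStronglyMeasurable (fun r => extensionKernel β s r • φ r)
      (volume.restrict (Ioi 0)) := fun β s =>
    ((continuousOn_extensionKernel β s).smul hφ).aestronglyMeasurable measurableSet_Ioi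
  have key := (hasDerivAt_integral_of_dominated_loc_of_deriv_le
    (μ := volume.restrict (Ioi (0 : ℝ)))
    (F := fun s r => extensionKernel α s r • φ r)
    (F' := fun s r => (-((s / 2 : ℝ) : ℂ) * extensionKernel (α + 1) s r) • φ r)
    (x₀ := t) (s := Icc (t / 2) (2 * t))
    (bound := fun r => t * (r ^ (-((α + 1).re + 1)) * Real.exp (-((t / 2) ^ 2 / 4) / r) * B))
    (Icc_mem_nhds (by linarith) (by linarith)) (.of_forall fun s => hmeas α s)
    (integrableOn_extensionKernel_smul hα ht hφ hB)
    ((((continuousOn_const.mul (continuousOn_extensionKernel (α + 1) t)).smul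
      hφ).aestronglyMeasurable measurableSet_Ioi))
    ?_ ?_ ?_).2
  · simpa only [mul_smul, integral_smul] using key
  · refine (ae_restrict_iff' measurableSet_Ioi).2 (.of_forall fun r hr s hs => ?_)
    have hr : 0 < r := hr
    rw [norm_smul, norm_mul, norm_neg, Complex.norm_real,
      Real.norm_of_nonneg (by linarith [hs.1] : 0 ≤ s / 2), mul_assoc]
    have := norm_extensionKernel_le (α + 1) (half_pos ht) hs.1 hr
    have h2 := hB r hr
    have h3 : s / 2 ≤ t := by linarith [hs.2]
    gcongr
  · exact ((integrableOn_rpow_neg_mul_exp_neg_div (by linarith) (by positivity)).mul_const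
      B).const_mul t
  · refine (ae_restrict_iff' measurableSet_Ioi).2 (.of_forall fun r hr s _ => ?_)
    exact (hasDerivAt_extensionKernel α s hr).smul_const (φ r)

/-- The kernel of `t ^ (1 - 2 * α) • U'(t)`, up to constants. -/
noncomputable def fluxKernel (α : ℂ) (t r : ℝ) : ℂ :=
  α * extensionKernel α t r - ((t ^ 2 / 4 : ℝ) : ℂ) * extensionKernel (α + 1) t r

theorem integrableOn_fluxKernel_smul {α : ℂ} (hα : 0 < α.re) {t : ℝ} (ht : 0 < t)
    {φ : ℝ → X} {B : ℝ} (hφ : ContinuousOn φ (Ioi 0)) (hB : ∀ r, 0 < r → ‖φ r‖ ≤ B) :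
    IntegrableOn (fun r => fluxKernel α t r • φ r) (Ioi 0) := by
  have hα1 : 0 < (α + 1).re := by simp; linarith
  simp only [fluxKernel, sub_smul, mul_smul]
  exact ((integrableOn_extensionKernel_smul hα ht hφ hB).smul α).sub
    ((integrableOn_extensionKernel_smul hα1 ht hφ hB).smul ((t ^ 2 / 4 : ℝ) : ℂ))

theorem hasDerivAt_extension {α : ℂ} (hα : 0 < α.re) {t : ℝ} (ht : 0 < t)
    {φ : ℝ → X} {B : ℝ} (hφ : ContinuousOn φ (Ioi 0)) (hB : ∀ r, 0 < r → ‖φ r‖ ≤ B) :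
    HasDerivAt (fun s : ℝ => (1 / Complex.Gamma α) • ((((s : ℂ) / 2) ^ (2 * α)) •
        ∫ r in Ioi (0 : ℝ), extensionKernel α s r • φ r))
      ((1 / Complex.Gamma α * ((t : ℂ) / 2) ^ (2 * α - 1)) •
        ∫ r in Ioi (0 : ℝ), fluxKernel α t r • φ r) t := by
  have hα0 : α ≠ 0 := fun h => by simp [h] at hα
  have hα1 : 0 < (α + 1).re := by simp; linarith
  have ht2 : (t : ℂ) / 2 ≠ 0 := by simpa using ht.ne'
  have hp : HasDerivAt (fun s : ℝ => ((s : ℂ) / 2) ^ (2 * α))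
      (α * ((t : ℂ) / 2) ^ (2 * α - 1)) t := by
    have h1 : HasDerivAt (fun s : ℝ => s / 2) (1 / 2) t := (hasDerivAt_id t).div_const 2
    have h2 := HasDerivAt.scomp t (hasDerivAt_ofReal_cpow_const (x := t / 2) (by positivity)
      (r := 2 * α) (by simpa using hα0)) h1
    refine (h2.congr_deriv ?_).congr_of_eventuallyEq (.of_forall fun s => ?_)
    · rw [Complex.real_smul]; push_cast; ring
    · simp [Function.comp]
  refine ((hp.smul (hasDerivAt_integral_extensionKernel hα ht hφ hB)).const_smul
    (1 / Complex.Gamma α)).congr_deriv ?_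
  have hpow : ((t : ℂ) / 2) ^ (2 * α) = ((t : ℂ) / 2) ^ (2 * α - 1) * ((t : ℂ) / 2) := by
    rw [Complex.cpow_sub _ _ ht2, Complex.cpow_one, div_mul_cancel₀ _ ht2]
  have hint : ∫ r in Ioi (0 : ℝ), fluxKernel α t r • φ r =
      α • (∫ r in Ioi (0 : ℝ), extensionKernel α t r • φ r) -
      ((t ^ 2 / 4 : ℝ) : ℂ) • ∫ r in Ioi (0 : ℝ), extensionKernel (α + 1) t r • φ r := by
    simp only [fluxKernel, sub_smul, mul_smul]
    rw [← integral_smul, ← integral_smul]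
    exact integral_sub ((integrableOn_extensionKernel_smul hα ht hφ hB).smul α)
      ((integrableOn_extensionKernel_smul hα1 ht hφ hB).smul ((t ^ 2 / 4 : ℝ) : ℂ))
  rw [hint, hpow]
  push_cast
  module

end Banach

theorem integral_fluxKernel {α : ℂ} (hα : 0 < α.re) {t : ℝ} (ht : 0 < t) :
    ∫ r in Ioi (0 : ℝ), fluxKernel α t r = 0 := by
  have hα0 : α ≠ 0 := fun h => by simp [h] at hα
  set f : ℝ → ℂ := fun r => -((r : ℂ) ^ (-α) * (Real.exp (-(t ^ 2) / (4 * r)) : ℂ)) with hf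
  have hnorm : ∀ r, 0 < r → ‖f r‖ = r ^ (-α.re) * Real.exp (-(t ^ 2 / 4) * r⁻¹) := by
    intro r hr
    rw [hf]
    simp only [norm_neg, norm_mul]
    rw [Complex.norm_cpow_eq_rpow_re_of_pos hr, Complex.norm_real,
      Real.norm_of_nonneg (Real.exp_pos _).le, Complex.neg_re]
    congr 2
    field_simp
  have hf0 : f 0 = 0 := by simp [hf, hα0]
  have h := integral_Ioi_of_hasDerivAt_of_tendsto (f := f) (f' := fluxKernel α t) (a := 0) (m := 0)
    ?_ ?_ ?_ ?_
  · rw [h, hf0, sub_zero]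
  · rw [← continuousWithinAt_Ioi_iff_Ici]
    show Tendsto f (𝓝[>] 0) (𝓝 (f 0))
    rw [hf0, tendsto_zero_iff_norm_tendsto_zero]
    refine ((tendsto_rpow_mul_exp_neg_mul_atTop_nhds_zero α.re (t ^ 2 / 4)
      (by positivity)).comp tendsto_inv_nhdsGT_zero).congr' ?_
    filter_upwards [self_mem_nhdsWithin] with r hr
    rw [hnorm r hr, Function.comp, Real.inv_rpow (le_of_lt hr), Real.rpow_neg (le_of_lt hr)]
  · intro r hr
    have hr : 0 < r := hr
    have hr' : (r : ℂ) ≠ 0 := by exact_mod_cast hr.ne'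
    have h1 := hasDerivAt_ofReal_cpow_const hr.ne' (neg_ne_zero.2 hα0)
    have h2 : HasDerivAt (fun r : ℝ => Real.exp (-(t ^ 2) / (4 * r)))
        (Real.exp (-(t ^ 2) / (4 * r)) * (t ^ 2 / (4 * r ^ 2))) r := by
      have := ((hasDerivAt_const r (-(t ^ 2))).fun_div ((hasDerivAt_id r).const_mul 4)
        (by simpa using hr.ne')).exp
      refine this.congr_deriv ?_
      simp only [id]
      field_simp
      ring
    refine ((h1.mul h2.ofReal_comp).neg).congr_deriv ?_
    have h3 : (r : ℂ) ^ (-(α + 1) - 1) = (r : ℂ) ^ (-α) / r ^ 2 := by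
      rw [show -(α + 1) - 1 = -α - (2 : ℕ) by push_cast; ring, Complex.cpow_sub _ _ hr',
        Complex.cpow_natCast]
    rw [fluxKernel, extensionKernel, extensionKernel, h3]
    push_cast
    field_simp
    ring
  · simpa using integrableOn_fluxKernel_smul hα ht (φ := fun _ => (1 : ℂ)) (B := 1)
      continuousOn_const (by simp)
  · rw [tendsto_zero_iff_norm_tendsto_zero]
    refine squeeze_zero' (.of_forall fun _ => norm_nonneg _) ?_ (tendsto_rpow_neg_atTop hα)
    filter_upwards [eventually_gt_atTop 0] with r hr
    rw [hnorm r hr]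
    refine mul_le_of_le_one_right (by positivity) (Real.exp_le_one_iff.2 ?_)
    have : 0 < t ^ 2 / 4 * r⁻¹ := by positivity
    linarith

theorem norm_fluxKernel_le (α : ℂ) (t : ℝ) {r : ℝ} (hr : 0 < r) :
    ‖fluxKernel α t r‖ ≤ (‖α‖ + 1) * r ^ (-(α.re + 1)) := by
  set u := t ^ 2 / 4 / r with hu
  have hu0 : 0 ≤ u := by positivity
  have he : Real.exp (-(t ^ 2 / 4) / r) = Real.exp (-u) := by rw [hu, neg_div]
  have he1 : Real.exp (-u) ≤ 1 := Real.exp_le_one_iff.2 (by linarith)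
  have he2 : u * Real.exp (-u) ≤ 1 := by
    rw [Real.exp_neg, ← div_eq_mul_inv, div_le_one (Real.exp_pos _)]
    linarith [Real.add_one_le_exp u]
  have hp : r ^ (-((α + 1).re + 1)) = r ^ (-(α.re + 1)) / r := by
    rw [← Real.rpow_sub_one hr.ne']; congr 1; simp; ring
  calc ‖fluxKernel α t r‖
      ≤ ‖α‖ * (r ^ (-(α.re + 1)) * Real.exp (-u)) +
        t ^ 2 / 4 * (r ^ (-(α.re + 1)) / r * Real.exp (-u)) := by
        refine (norm_sub_le _ _).trans_eq ?_
        rw [norm_mul, norm_mul, norm_extensionKernel _ _ hr, norm_extensionKernel _ _ hr, he, hp,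
          Complex.norm_real, Real.norm_of_nonneg (by positivity)]
    _ = r ^ (-(α.re + 1)) * (‖α‖ * Real.exp (-u) + u * Real.exp (-u)) := by rw [hu]; ring
    _ ≤ r ^ (-(α.re + 1)) * (‖α‖ * 1 + 1) := by gcongr
    _ = _ := by ring

theorem integrableOn_rpow_mul_min {a : ℝ} (h0 : 0 < a) (h1 : a < 1) :
    IntegrableOn (fun r : ℝ => r ^ (-(a + 1)) * min r 1) (Ioi 0) := by
  rw [← Ioc_union_Ioi_eq_Ioi zero_le_one]
  refine IntegrableOn.union ?_ ?_
  · have h := (intervalIntegrable_iff_integrableOn_Ioc_of_le zero_le_one).1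
      (intervalIntegral.intervalIntegrable_rpow' (a := 0) (b := 1) (r := -a) (by linarith))
    refine h.congr_fun (fun r hr => ?_) measurableSet_Ioc
    simp only
    rw [min_eq_left hr.2, ← Real.rpow_add_one hr.1.ne']
    ring_nf
  · have h := integrableOn_Ioi_rpow_of_lt (a := -(a + 1)) (by linarith) one_pos
    refine h.congr_fun (fun r hr => ?_) measurableSet_Ioi
    simp only
    rw [min_eq_right (le_of_lt hr), mul_one]

/-- A bounded curve that leaves its starting point at most linearly has a flux bounded uniformly
in `t`. -/
theorem norm_integral_fluxKernel_smul_le {X : Type*} [NormedAddCommGroup X] [NormedSpace ℂ X]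
    [CompleteSpace X] {α : ℂ} (h0 : 0 < α.re) (h1 : α.re < 1) {t : ℝ} (ht : 0 < t)
    {φ : ℝ → X} {z : X} {K : ℝ} (hφ : ContinuousOn φ (Ioi 0))
    (hK : ∀ r, 0 < r → ‖φ r - z‖ ≤ K * min r 1) :
    ‖∫ r in Ioi (0 : ℝ), fluxKernel α t r • φ r‖ ≤
      (‖α‖ + 1) * (∫ r in Ioi (0 : ℝ), r ^ (-(α.re + 1)) * min r 1) * K := by
  have hK0 : 0 ≤ K := by simpa using (norm_nonneg _).trans (hK 1 one_pos)
  have hB : ∀ r, 0 < r → ‖φ r‖ ≤ K + ‖z‖ := fun r hr => by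
    have := (hK r hr).trans (mul_le_of_le_one_right hK0 (min_le_right r 1))
    linarith [norm_le_norm_sub_add (φ r) z]
  have hz : ∫ r in Ioi (0 : ℝ), fluxKernel α t r • z = 0 := by
    rw [integral_smul_const, integral_fluxKernel h0 ht, zero_smul]
  have hsub : ∫ r in Ioi (0 : ℝ), fluxKernel α t r • φ r =
      ∫ r in Ioi (0 : ℝ), fluxKernel α t r • (φ r - z) := by
    simp only [smul_sub]
    rw [integral_sub (integrableOn_fluxKernel_smul h0 ht hφ hB)
      (integrableOn_fluxKernel_smul h0 ht continuousOn_const fun _ _ => le_rfl), hz, sub_zero]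
  rw [hsub, ← integral_const_mul, ← integral_mul_const]
  refine norm_integral_le_of_norm_le
    (((integrableOn_rpow_mul_min h0 h1).const_mul _).mul_const K) ?_
  refine (ae_restrict_iff' measurableSet_Ioi).2 (.of_forall fun r hr => ?_)
  have hr : 0 < r := hr
  rw [norm_smul]
  calc _ ≤ ((‖α‖ + 1) * r ^ (-(α.re + 1))) * (K * min r 1) := by
        gcongr
        · exact norm_fluxKernel_le α t hr
        · exact hK r hr
    _ = _ := by ring

/-- `A` non-negative in a Banach space `X`, `-A_D` generating a bounded `C₀`-semigroup
`(T(t))` on `D := closure D(A)`.  The operator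
`T_α x := lim_{t→0+} (-t^{1-2α} U'(t)x)`, defined on those `x ∈ D` for which the limit
exists, is closable: if `(0, y)` is in the closure of its graph then `y = 0`. -/
theorem stmt13 {X : Type*} [NormedAddCommGroup X] [NormedSpace ℂ X] [CompleteSpace X]
    (A : X →ₗ.[ℂ] X) (R : ℝ → X →L[ℂ] X) (M : ℝ)
    (α : ℂ) (h0 : 0 < α.re) (h1 : α.re < 1)
    (hR : ∀ l : ℝ, 0 < l → ∀ y : X,
      ∃ h : R l y ∈ A.domain, A ⟨R l y, h⟩ + (l : ℂ) • R l y = y)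
    (hRinv : ∀ l : ℝ, 0 < l → ∀ x : A.domain, R l (A x + (l : ℂ) • (x : X)) = x)
    (hM : ∀ l : ℝ, 0 < l → ‖(l : ℂ) • R l‖ ≤ M)
    (T : ℝ → X →L[ℂ] X)
    (hTD : ∀ t : ℝ, 0 ≤ t → ∀ y ∈ closure (A.domain : Set X),
      T t y ∈ closure (A.domain : Set X))
    (hT0 : ∀ y ∈ closure (A.domain : Set X), T 0 y = y)
    (hsemi : ∀ s t : ℝ, 0 ≤ s → 0 ≤ t → ∀ y ∈ closure (A.domain : Set X),
      T (s + t) y = T s (T t y))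
    (hcont : ∀ y ∈ closure (A.domain : Set X), ContinuousOn (fun t => T t y) (Ici 0))
    (hbdd : ∀ t : ℝ, 0 ≤ t → ∀ y ∈ closure (A.domain : Set X), ‖T t y‖ ≤ M * ‖y‖)
    (hgen : ∀ x : A.domain, ∀ t : ℝ, 0 ≤ t →
      ∃ hm : T t (x : X) ∈ A.domain,
        HasDerivAt (fun s => T s (x : X)) (-(A ⟨T t (x : X), hm⟩)) t)
    :
    ∀ y : X,
      ((0 : X), y) ∈ closure {p : X × X | p.1 ∈ closure (A.domain : Set X) ∧
        Tendsto (fun t : ℝ => -(((t : ℂ) ^ ((1 : ℂ) - 2 * α)) •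
            deriv (fun s : ℝ => (1 / Complex.Gamma α) •
              ((((s : ℂ) / 2) ^ (2 * α)) •
                ∫ r in Ioi (0:ℝ),
                  (((r : ℂ) ^ (-α - 1)) * (Real.exp (-(s ^ 2) / (4 * r)) : ℂ)) • T r p.1)) t))
          (𝓝[>] (0:ℝ)) (𝓝 p.2)} →
      y = 0 := by
  have hRD : ∀ x, R 1 x ∈ A.domain := fun x => (hR 1 one_pos x).1
  have hAT : ∀ r, 0 ≤ r → ∀ z : A.domain, ∀ hz : A z ∈ closure (A.domain : Set X),
      ∃ hm : T r (z : X) ∈ A.domain, A ⟨T r z, hm⟩ = T r (A z) := by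
    intro r hr z hz
    obtain ⟨hm, hd⟩ := hgen z r hr
    refine ⟨hm, ?_⟩
    obtain ⟨hm0, hd0⟩ := hgen z 0 le_rfl
    have hzD : (z : X) ∈ closure (A.domain : Set X) := subset_closure z.2
    have hA0 : A ⟨T 0 z, hm0⟩ = A z := by congr 1; exact Subtype.ext (hT0 z hzD)
    rw [hA0] at hd0
    have e1 : HasDerivWithinAt (fun h => T (r + h) (z : X)) (-(A ⟨T r z, hm⟩)) (Ici 0) 0 := by
      refine HasDerivAt.hasDerivWithinAt ?_
      have : HasDerivAt (fun s => T s (z : X)) (-(A ⟨T r z, hm⟩)) (r + 0) := by rwa [add_zero]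
      exact this.comp_const_add r 0
    have e2 : HasDerivWithinAt (fun h => T (r + h) (z : X)) (T r (-(A z))) (Ici 0) 0 := by
      have := (((T r).restrictScalars ℝ).hasFDerivAt.comp_hasDerivAt 0 hd0).hasDerivWithinAt
        (s := Ici 0)
      exact this.congr (fun h hh => hsemi r h hr hh z hzD) (hsemi r 0 hr le_rfl z hzD)
    have := (uniqueDiffOn_Ici (0 : ℝ) 0 self_mem_Ici).eq_deriv _ e1 e2
    simpa using this
  have hAR : ∀ x, A ⟨R 1 x, hRD x⟩ = x - R 1 x := fun x => by
    obtain ⟨h, e⟩ := hR 1 one_pos x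
    rw [eq_sub_iff_add_eq]
    simpa using e
  have hclosed : ∀ x ∈ closure (A.domain : Set X), A ⟨R 1 x, hRD x⟩ ∈ closure (A.domain : Set X) :=
    fun x hx => by
      rw [hAR]
      exact A.domain.topologicalClosure.sub_mem hx (subset_closure (hRD x))
  have hcomm : ∀ r, 0 ≤ r → ∀ x ∈ closure (A.domain : Set X), R 1 (T r x) = T r (R 1 x) := by
    intro r hr x hx
    obtain ⟨hm, e⟩ := hAT r hr ⟨R 1 x, hRD x⟩ (hclosed x hx)
    have h := hRinv 1 one_pos ⟨T r (R 1 x), hm⟩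
    rw [e, hAR] at h
    simpa using h
  have hM1 : ‖R 1‖ ≤ M := by simpa using hM 1 one_pos
  have hM0 : 0 ≤ M := (norm_nonneg _).trans hM1
  have hbound : ∀ x ∈ closure (A.domain : Set X), ∀ r, 0 < r →
      ‖T r (R 1 x) - R 1 x‖ ≤ (M * (1 + M) * ‖x‖) * min r 1 := by
    intro x hx r hr
    have hRx : ‖R 1 x‖ ≤ M * ‖x‖ := (R 1).le_of_opNorm_le hM1 x
    have hRc : R 1 x ∈ closure (A.domain : Set X) := subset_closure (hRD x)
    have hM2 : 0 ≤ M * (1 + M) * ‖x‖ := by positivity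
    rcases min_choice r 1 with h | h
    · rw [h]
      have key := Convex.norm_image_sub_le_of_norm_hasDerivWithin_le
        (f := fun s => T s (R 1 x)) (f' := fun s => -(T s (A ⟨R 1 x, hRD x⟩)))
        (s := Ici (0 : ℝ)) (x := 0) (y := r) (C := M * (1 + M) * ‖x‖) ?_ ?_ (convex_Ici 0)
        self_mem_Ici hr.le
      · rwa [hT0 _ hRc, sub_zero, Real.norm_of_nonneg hr.le] at key
      · intro s hs
        obtain ⟨hm, hd⟩ := hgen ⟨R 1 x, hRD x⟩ s hs
        obtain ⟨_, e⟩ := hAT s hs ⟨R 1 x, hRD x⟩ (hclosed x hx)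
        rw [e] at hd
        exact hd.hasDerivWithinAt
      · intro s hs
        rw [norm_neg]
        refine (hbdd s hs _ (hclosed x hx)).trans ?_
        rw [hAR, mul_assoc]
        gcongr
        linarith [norm_sub_le x (R 1 x)]
    · rw [h, mul_one]
      calc _ ≤ ‖T r (R 1 x)‖ + ‖R 1 x‖ := norm_sub_le _ _
        _ ≤ M * (M * ‖x‖) + M * ‖x‖ := by
          gcongr
          exact (hbdd r hr.le _ hRc).trans (by gcongr)
        _ = _ := by ring
  set I := ∫ r in Ioi (0 : ℝ), r ^ (-(α.re + 1)) * min r 1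
  set C := ‖1 / Complex.Gamma α‖ * (1 / 2) ^ (2 * α.re - 1) * ((‖α‖ + 1) * I * (M * (1 + M)))
    with hC
  intro y hy
  have hmain : ‖R 1 y‖ ≤ C * ‖(0 : X)‖ := by
    have hcl : IsClosed {p : X × X | ‖R 1 p.2‖ ≤ C * ‖p.1‖} :=
      isClosed_le (by fun_prop) (by fun_prop)
    refine hcl.closure_subset_iff.2 ?_ hy
    rintro ⟨x, w⟩ ⟨hx, hlim⟩
    refine le_of_tendsto (((R 1).continuous.tendsto w).comp hlim).norm ?_
    filter_upwards [self_mem_nhdsWithin] with t ht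
    have ht : 0 < t := ht
    have hTx : ∀ x ∈ closure (A.domain : Set X), ContinuousOn (fun r => T r x) (Ioi 0) :=
      fun x hx => (hcont x hx).mono Ioi_subset_Ici_self
    have hd := (hasDerivAt_extension h0 ht (hTx x hx) fun r hr => hbdd r hr.le x hx).deriv
    have hcomm' : R 1 (∫ r in Ioi (0 : ℝ), fluxKernel α t r • T r x) =
        ∫ r in Ioi (0 : ℝ), fluxKernel α t r • T r (R 1 x) := by
      rw [← (R 1).integral_comp_comm
        (integrableOn_fluxKernel_smul h0 ht (hTx x hx) fun r hr => hbdd r hr.le x hx)]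
      refine setIntegral_congr_fun measurableSet_Ioi fun r hr => ?_
      simp only [map_smul, hcomm r (le_of_lt hr) x hx]
    have hpow : ‖(t : ℂ) ^ (1 - 2 * α)‖ * ‖((t : ℂ) / 2) ^ (2 * α - 1)‖ =
        (1 / 2) ^ (2 * α.re - 1) := by
      have h2 : (t : ℂ) / 2 = ((t * (1 / 2) : ℝ) : ℂ) := by push_cast; ring
      rw [h2, Complex.norm_cpow_eq_rpow_re_of_pos ht,
        Complex.norm_cpow_eq_rpow_re_of_pos (by positivity)]
      have e1 : (1 - 2 * α).re = -(2 * α.re - 1) := by simp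
      have e2 : (2 * α - 1).re = 2 * α.re - 1 := by simp
      rw [e1, e2, Real.mul_rpow ht.le (by norm_num), ← mul_assoc, ← Real.rpow_add ht,
        neg_add_cancel, Real.rpow_zero, one_mul]
    simp only [extensionKernel] at hd
    simp only [Function.comp, hd, map_neg, map_smul, hcomm', norm_neg, norm_smul, norm_mul]
    calc _ = ‖1 / Complex.Gamma α‖ *
          (‖(t : ℂ) ^ (1 - 2 * α)‖ * ‖((t : ℂ) / 2) ^ (2 * α - 1)‖) *
          ‖∫ r in Ioi (0 : ℝ), fluxKernel α t r • T r (R 1 x)‖ := by ring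
      _ ≤ ‖1 / Complex.Gamma α‖ * (1 / 2) ^ (2 * α.re - 1) *
          ((‖α‖ + 1) * I * (M * (1 + M) * ‖x‖)) := by
        rw [hpow]
        gcongr
        exact norm_integral_fluxKernel_smul_le h0 h1 ht
          (hTx _ (subset_closure (hRD x))) (hbound x hx)
      _ = C * ‖x‖ := by rw [hC]; ring
  have hRy : R 1 y = 0 := by simpa using hmain
  have h := hAR y
  have hz : (⟨R 1 y, hRD y⟩ : A.domain) = 0 := Subtype.ext hRy
  rw [hz, hRy, LinearPMap.map_zero, sub_zero] at h
  exact h.symm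
end

section
/- Let w ∈ ℂ with Re w > 0, g ∈ ℂ, 0 < α < 1 real, u(t) := (2g/Γ(α))(t w^{1/2}/2)^α K_α(t w^{1/2}). Then lim_{t→0+} (−t^{1-2α} u'(t)) = c_α w^α g, where c_α = Γ(1-α)/(2^{2α-1}Γ(α)). -/
open MeasureTheory Set Filter Topology

/-- The modified Bessel function of the second kind, via its integral representation
`K_ν(z) = ∫_0^∞ e^{-z cosh t} cosh(ν t) dt` (valid for `Re z > 0`). -/
noncomputable def besselK (ν z : ℂ) : ℂ :=
  ∫ t in Ioi (0:ℝ), Complex.exp (-z * Real.cosh t) * Complex.cosh (ν * t)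


/-- The integral `∫ exp (ν y - z (e^y + c e^{-y})) dy` over the real line, which interpolates
between `Γ(ν) z^{-ν}` (at `c = 0`) and `2 K_ν(2z)` (at `c = 1`). -/
noncomputable def gammaBessel (ν c : ℝ) (z : ℂ) : ℂ :=
  ∫ y : ℝ, Complex.exp (ν * y - z * ((Real.exp y + c * Real.exp (-y) : ℝ) : ℂ))

lemma exists_mul_sub_mul_exp_le (b : ℝ) {x : ℝ} (hx : 0 < x) :
    ∃ C, ∀ y, 0 ≤ y → b * y - x * Real.exp y ≤ C := by
  have hm : 0 < max b 1 := by positivity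
  set m := max b 1
  have hk : Real.exp (Real.log (m / x)) = m / x := Real.exp_log (by positivity)
  refine ⟨m * (Real.log (m / x) - 1), fun y hy => ?_⟩
  have h := Real.add_one_le_exp (y - Real.log (m / x))
  rw [Real.exp_sub, hk, le_div_iff₀ (by positivity)] at h
  have h2 : x * ((y - Real.log (m / x) + 1) * (m / x)) = m * (y - Real.log (m / x) + 1) := by
    field_simp
  have h3 := mul_le_mul_of_nonneg_left h hx.le
  have h4 : b * y ≤ m * y := mul_le_mul_of_nonneg_right (le_max_left _ _) hy
  rw [h2] at h3
  linarith

lemma integrable_exp_sub_mul_exp_add {ν c x : ℝ} (hc : 0 ≤ c) (hνc : 0 < ν ∨ 0 < c) (hx : 0 < x) :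
    Integrable (fun y : ℝ => Real.exp (ν * y - x * (Real.exp y + c * Real.exp (-y)))) := by
  have hcont : Continuous
      (fun y : ℝ => Real.exp (ν * y - x * (Real.exp y + c * Real.exp (-y)))) := by fun_prop
  rw [← integrableOn_univ, ← Iic_union_Ioi (a := (0 : ℝ)), integrableOn_union]
  constructor
  · obtain ⟨μ, C, hμ, hC⟩ : ∃ μ C : ℝ, 0 < μ ∧ ∀ y ≤ 0,
        ν * y - x * (Real.exp y + c * Real.exp (-y)) ≤ C + μ * y := by
      rcases hνc with hν | hc
      · refine ⟨ν, 0, hν, fun y _ => ?_⟩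
        have : 0 ≤ x * (Real.exp y + c * Real.exp (-y)) := by positivity
        linarith
      · obtain ⟨C, hC⟩ := exists_mul_sub_mul_exp_le (1 - ν) (mul_pos hx hc)
        refine ⟨1, C, one_pos, fun y hy => ?_⟩
        have h1 := hC (-y) (by linarith)
        have h2 : 0 < x * Real.exp y := by positivity
        linarith
    refine Integrable.mono' ((integrableOn_exp_mul_Iic hμ 0).const_mul (Real.exp C))
      hcont.aestronglyMeasurable ?_
    filter_upwards [ae_restrict_mem measurableSet_Iic] with y hy
    rw [Real.norm_eq_abs, Real.abs_exp, ← Real.exp_add]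
    exact Real.exp_le_exp.2 (hC y hy)
  · obtain ⟨C, hC⟩ := exists_mul_sub_mul_exp_le (ν + 1) hx
    refine Integrable.mono' ((integrableOn_exp_mul_Ioi (neg_lt_zero.2 one_pos) 0).const_mul
      (Real.exp C)) hcont.aestronglyMeasurable ?_
    filter_upwards [ae_restrict_mem measurableSet_Ioi] with y hy
    rw [Real.norm_eq_abs, Real.abs_exp, ← Real.exp_add]
    refine Real.exp_le_exp.2 ?_
    have h1 := hC y (le_of_lt hy)
    have h2 : 0 ≤ x * (c * Real.exp (-y)) := by positivity
    linarith

lemma norm_exp_sub_mul_ofReal (ν y p : ℝ) (z : ℂ) :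
    ‖Complex.exp (ν * y - z * (p : ℂ))‖ = Real.exp (ν * y - z.re * p) := by
  rw [Complex.norm_exp]
  simp

lemma integrable_gammaBessel {ν c : ℝ} {z : ℂ} (hc : 0 ≤ c) (hνc : 0 < ν ∨ 0 < c) (hz : 0 < z.re) :
    Integrable (fun y : ℝ =>
      Complex.exp (ν * y - z * ((Real.exp y + c * Real.exp (-y) : ℝ) : ℂ))) := by
  refine (integrable_exp_sub_mul_exp_add hc hνc hz).mono'
    (Continuous.aestronglyMeasurable (by fun_prop)) (.of_forall fun y => ?_)
  rw [norm_exp_sub_mul_ofReal]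

lemma mul_exp_sub_mul_le {a p x x' : ℝ} (hx : 0 < x) (hp : 0 ≤ p) (hx' : x ≤ x') :
    p * Real.exp (a - x' * p) ≤ 2 / x * Real.exp (a - x / 2 * p) := by
  have h1 : x / 2 * p ≤ Real.exp (x / 2 * p) := by linarith [Real.add_one_le_exp (x / 2 * p)]
  have h2 : p ≤ 2 / x * Real.exp (x / 2 * p) := by
    rw [div_mul_eq_mul_div, le_div_iff₀ hx]; linarith
  calc p * Real.exp (a - x' * p) ≤ p * Real.exp (a - x * p) := by gcongr
    _ ≤ 2 / x * Real.exp (x / 2 * p) * Real.exp (a - x * p) := by gcongr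
    _ = 2 / x * Real.exp (a - x / 2 * p) := by
      rw [mul_assoc, ← Real.exp_add]; ring_nf

lemma hasDerivAt_gammaBessel {ν c : ℝ} {z : ℂ} (hc : 0 ≤ c) (hνc : 0 < ν ∨ 0 < c)
    (hz : 0 < z.re) :
    Integrable (fun y : ℝ => -((Real.exp y + c * Real.exp (-y) : ℝ) : ℂ) *
        Complex.exp (ν * y - z * ((Real.exp y + c * Real.exp (-y) : ℝ) : ℂ))) ∧
    HasDerivAt (gammaBessel ν c) (∫ y : ℝ, -((Real.exp y + c * Real.exp (-y) : ℝ) : ℂ) *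
        Complex.exp (ν * y - z * ((Real.exp y + c * Real.exp (-y) : ℝ) : ℂ))) z := by
  have hs : {w : ℂ | z.re / 2 < w.re} ∈ 𝓝 z :=
    (isOpen_lt continuous_const Complex.continuous_re).mem_nhds (by simp; linarith)
  refine hasDerivAt_integral_of_dominated_loc_of_deriv_le (𝕜 := ℂ)
    (F := fun z y => Complex.exp (ν * y - z * ((Real.exp y + c * Real.exp (-y) : ℝ) : ℂ)))
    (F' := fun z y => -((Real.exp y + c * Real.exp (-y) : ℝ) : ℂ) *
        Complex.exp (ν * y - z * ((Real.exp y + c * Real.exp (-y) : ℝ) : ℂ)))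
    (bound := fun y => 2 / (z.re / 2) *
      Real.exp (ν * y - z.re / 2 / 2 * (Real.exp y + c * Real.exp (-y))))
    hs (.of_forall fun w => Continuous.aestronglyMeasurable (by fun_prop))
    (integrable_gammaBessel hc hνc hz) (Continuous.aestronglyMeasurable (by fun_prop))
    (.of_forall fun y w hw => ?_)
    ((integrable_exp_sub_mul_exp_add hc hνc (by positivity)).const_mul _)
    (.of_forall fun y w _ => ?_)
  · have hp : 0 ≤ Real.exp y + c * Real.exp (-y) := by positivity
    rw [norm_mul, norm_neg, norm_exp_sub_mul_ofReal, Complex.norm_real, Real.norm_of_nonneg hp]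
    exact mul_exp_sub_mul_le (by positivity) hp (le_of_lt hw)
  · convert! (((hasDerivAt_id' w).mul_const
      ((Real.exp y + c * Real.exp (-y) : ℝ) : ℂ)).const_sub (ν * y : ℂ)).cexp using 1
    ring

/-- Integration by parts. -/
lemma integral_gammaBessel_by_parts {ν c : ℝ} {z : ℂ} (hc : 0 ≤ c) (hνc : 0 < ν ∨ 0 < c)
    (hz : 0 < z.re) :
    Integrable (fun y : ℝ => ((Real.exp y - c * Real.exp (-y) : ℝ) : ℂ) *
        Complex.exp (ν * y - z * ((Real.exp y + c * Real.exp (-y) : ℝ) : ℂ))) ∧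
    z * ∫ y : ℝ, ((Real.exp y - c * Real.exp (-y) : ℝ) : ℂ) *
        Complex.exp (ν * y - z * ((Real.exp y + c * Real.exp (-y) : ℝ) : ℂ)) =
      ν * gammaBessel ν c z := by
  have hI : Integrable (fun y : ℝ => ((Real.exp y - c * Real.exp (-y) : ℝ) : ℂ) *
        Complex.exp (ν * y - z * ((Real.exp y + c * Real.exp (-y) : ℝ) : ℂ))) := by
    refine (hasDerivAt_gammaBessel hc hνc hz).1.mono
      (Continuous.aestronglyMeasurable (by fun_prop)) (.of_forall fun y => ?_)
    rw [norm_mul, norm_mul, norm_neg, Complex.norm_real, Complex.norm_real]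
    gcongr
    have h1 := Real.exp_pos y
    have h2 : 0 ≤ c * Real.exp (-y) := by positivity
    rw [Real.norm_eq_abs, Real.norm_eq_abs, abs_of_nonneg (add_nonneg h1.le h2), abs_le]
    constructor <;> linarith
  refine ⟨hI, ?_⟩
  have hF := integrable_gammaBessel hc hνc hz
  have key := integral_eq_zero_of_hasDerivAt_of_integrable
    (f := fun y : ℝ => Complex.exp (ν * y - z * ((Real.exp y + c * Real.exp (-y) : ℝ) : ℂ)))
    (f' := fun y : ℝ =>
      ν * Complex.exp (ν * y - z * ((Real.exp y + c * Real.exp (-y) : ℝ) : ℂ)) -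
      z * (((Real.exp y - c * Real.exp (-y) : ℝ) : ℂ) *
        Complex.exp (ν * y - z * ((Real.exp y + c * Real.exp (-y) : ℝ) : ℂ))))
    (fun y => ?_) ((hF.const_mul _).sub (hI.const_mul _)) hF
  · rw [integral_sub (hF.const_mul _) (hI.const_mul _), integral_const_mul,
      integral_const_mul, sub_eq_zero] at key
    exact key.symm
  · have hp : HasDerivAt (fun y : ℝ => Real.exp y + c * Real.exp (-y))
        (Real.exp y - c * Real.exp (-y)) y := by
      convert! (Real.hasDerivAt_exp y).add ((hasDerivAt_neg y).exp.const_mul c) using 1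
      ring
    convert! ((((hasDerivAt_id' y).ofReal_comp.const_mul (ν : ℂ)).sub
      (hp.ofReal_comp.const_mul z))).cexp using 1
    simp only [Complex.ofReal_one, Pi.sub_apply]
    ring

lemma gammaBessel_zero_hasDerivAt {ν : ℝ} {z : ℂ} (hν : 0 < ν) (hz : 0 < z.re) :
    HasDerivAt (gammaBessel ν 0) (-(ν / z) * gammaBessel ν 0 z) z := by
  convert! (hasDerivAt_gammaBessel le_rfl (.inl hν) hz).2 using 1
  have hz0 : z ≠ 0 := by rintro rfl; simp at hz
  have h := (integral_gammaBessel_by_parts le_rfl (.inl hν) hz).2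
  simp only [zero_mul, sub_zero, add_zero, neg_mul] at h ⊢
  rw [integral_neg, div_mul_eq_mul_div, ← h, mul_div_cancel_left₀ _ hz0]

lemma gammaBessel_zero_one {ν : ℝ} (hν : 0 < ν) : gammaBessel ν 0 1 = Complex.Gamma ν := by
  rw [Complex.Gamma_eq_integral (by simpa using hν), Complex.GammaIntegral, ← Real.range_exp,
    ← image_univ, integral_image_eq_integral_abs_deriv_smul MeasurableSet.univ
      (fun y _ => (Real.hasDerivAt_exp y).hasDerivWithinAt) Real.exp_injective.injOn,
    setIntegral_univ]
  refine integral_congr_ae (.of_forall fun y => ?_)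
  simp only [Real.abs_exp, Complex.real_smul]
  rw [Complex.cpow_def_of_ne_zero (by simp), ← Complex.ofReal_log (Real.exp_pos y).le,
    Real.log_exp]
  push_cast
  rw [← Complex.exp_add, ← Complex.exp_add]
  ring_nf

lemma gammaBessel_zero {ν : ℝ} {z : ℂ} (hν : 0 < ν) (hz : 0 < z.re) :
    gammaBessel ν 0 z = Complex.Gamma ν * z ^ (-(ν : ℂ)) := by
  have hd : ∀ w ∈ {w : ℂ | 0 < w.re},
      HasDerivAt (fun w : ℂ => w ^ (ν : ℂ) * gammaBessel ν 0 w) 0 w := by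
    intro w hw
    have hw0 : w ≠ 0 := by rintro rfl; simp at hw
    convert! ((hasDerivAt_id' w).cpow_const (c := (ν : ℂ)) (.inl hw)).mul
      (gammaBessel_zero_hasDerivAt hν hw) using 1
    rw [Complex.cpow_sub _ _ hw0, Complex.cpow_one]
    field_simp
    ring
  have hopen : IsOpen {w : ℂ | 0 < w.re} := isOpen_lt continuous_const Complex.continuous_re
  have hz0 : z ≠ 0 := by rintro rfl; simp at hz
  have h := hopen.is_const_of_deriv_eq_zero
    (convex_halfSpace_re_gt 0).isPreconnected
    (fun w hw => (hd w hw).differentiableAt.differentiableWithinAt)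
    (fun w hw => (hd w hw).deriv) (show z ∈ {w : ℂ | 0 < w.re} from hz)
    (show (1 : ℂ) ∈ {w : ℂ | 0 < w.re} by simp)
  simp only [Complex.one_cpow, one_mul, gammaBessel_zero_one hν] at h
  rw [← h, Complex.cpow_neg]
  have : z ^ (ν : ℂ) ≠ 0 := by simp [Complex.cpow_eq_zero_iff, hz0]
  field_simp

lemma tendsto_gammaBessel_sq {ν : ℝ} {z : ℂ} (hν : 0 < ν) (hz : 0 < z.re) :
    Tendsto (fun t : ℝ => gammaBessel ν (t ^ 2) z) (𝓝[>] 0)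
      (𝓝 (Complex.Gamma ν * z ^ (-(ν : ℂ)))) := by
  rw [← gammaBessel_zero hν hz]
  refine tendsto_integral_filter_of_dominated_convergence
    (fun y => Real.exp (ν * y - z.re * (Real.exp y + 0 * Real.exp (-y))))
    (.of_forall fun t => Continuous.aestronglyMeasurable (by fun_prop))
    (.of_forall fun t => .of_forall fun y => ?_)
    (integrable_exp_sub_mul_exp_add le_rfl (.inl hν) hz) (.of_forall fun y => ?_)
  · rw [norm_exp_sub_mul_ofReal]
    gcongr
    positivity
  · have : Continuous (fun t : ℝ =>
        Complex.exp (ν * y - z * ((Real.exp y + t ^ 2 * Real.exp (-y) : ℝ) : ℂ))) := by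
      fun_prop
    simpa using (this.tendsto 0).mono_left nhdsWithin_le_nhds

lemma gammaBessel_mul {ν t : ℝ} (z : ℂ) (ht : 0 < t) :
    gammaBessel ν (t ^ 2) z = (t : ℂ) ^ (ν : ℂ) * gammaBessel ν 1 (t * z) := by
  have ht0 : (t : ℂ) ≠ 0 := by exact_mod_cast ht.ne'
  unfold gammaBessel
  rw [← integral_add_right_eq_self _ (Real.log t), ← integral_const_mul]
  refine integral_congr_ae (.of_forall fun y => ?_)
  simp only [neg_add, Real.exp_add, Real.exp_log ht, Complex.cpow_def_of_ne_zero ht0,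
    ← Complex.ofReal_log ht.le]
  rw [← Complex.exp_add, Real.exp_neg (Real.log t), Real.exp_log ht]
  congr 1
  push_cast
  field_simp
  ring

lemma gammaBessel_one_neg (ν : ℝ) (z : ℂ) : gammaBessel (-ν) 1 z = gammaBessel ν 1 z := by
  unfold gammaBessel
  rw [← integral_neg_eq_self]
  refine integral_congr_ae (.of_forall fun y => ?_)
  simp only
  congr 1
  push_cast
  ring_nf

lemma besselK_eq_gammaBessel {ν : ℝ} {z : ℂ} (hz : 0 < z.re) :
    besselK ν z = gammaBessel ν 1 (z / 2) / 2 := by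
  have hI := integrable_gammaBessel (ν := ν) (c := 1) (z := z / 2) zero_le_one (.inr one_pos)
    (by simpa using hz)
  have h1 := integral_comp_neg_Ioi (0 : ℝ) (fun y : ℝ =>
    Complex.exp (ν * y - z / 2 * ((Real.exp y + 1 * Real.exp (-y) : ℝ) : ℂ)))
  rw [neg_zero] at h1
  unfold gammaBessel besselK
  rw [← integral_add_compl measurableSet_Iic hI (s := Iic (0 : ℝ)), compl_Iic, ← h1,
    ← integral_add (hI.comp_neg.integrableOn) hI.integrableOn,
    ← integral_div]
  refine integral_congr_ae (.of_forall fun y => ?_)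
  simp only [neg_neg, one_mul, Complex.ofReal_cosh, Complex.cosh, Complex.ofReal_neg,
    Complex.ofReal_add, Complex.ofReal_exp]
  rw [mul_div_assoc', mul_add, ← Complex.exp_add, ← Complex.exp_add]
  ring_nf

lemma hasDerivAt_gammaBessel_one {ν : ℝ} {z : ℂ} (hz : 0 < z.re) :
    HasDerivAt (gammaBessel ν 1)
      (-(ν / z) * gammaBessel ν 1 z - 2 * gammaBessel (ν - 1) 1 z) z := by
  obtain ⟨hi, hd⟩ := hasDerivAt_gammaBessel (ν := ν) zero_le_one (.inr one_pos) hz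
  obtain ⟨hj, he⟩ := integral_gammaBessel_by_parts (ν := ν) zero_le_one (.inr one_pos) hz
  convert! hd using 1
  have hz0 : z ≠ 0 := by rintro rfl; simp at hz
  rw [neg_mul, div_mul_eq_mul_div, ← he, mul_div_cancel_left₀ _ hz0, gammaBessel,
    ← integral_const_mul, ← integral_neg, ← integral_sub hj.fun_neg
      ((integrable_gammaBessel zero_le_one (.inr one_pos) hz).const_mul _)]
  refine integral_congr_ae (.of_forall fun y => ?_)
  have : Complex.exp (((ν - 1 : ℝ) : ℂ) * y -
      z * ((Real.exp y + 1 * Real.exp (-y) : ℝ) : ℂ)) = ((Real.exp (-y) : ℝ) : ℂ) *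
      Complex.exp (ν * y - z * ((Real.exp y + 1 * Real.exp (-y) : ℝ) : ℂ)) := by
    rw [Complex.ofReal_exp (-y), ← Complex.exp_add]
    congr 1
    push_cast
    ring
  simp only [this]
  push_cast
  ring

lemma hasDerivAt_cpow_mul_gammaBessel_one {ν : ℝ} {z : ℂ} (hz : 0 < z.re) :
    HasDerivAt (fun z : ℂ => z ^ (ν : ℂ) * gammaBessel ν 1 z)
      (-2 * z ^ (ν : ℂ) * gammaBessel (1 - ν) 1 z) z := by
  have hz0 : z ≠ 0 := by rintro rfl; simp at hz
  convert! ((hasDerivAt_id' z).cpow_const (c := (ν : ℂ)) (.inl hz)).mul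
    (hasDerivAt_gammaBessel_one (ν := ν) hz) using 1
  rw [Complex.cpow_sub _ _ hz0, Complex.cpow_one, ← gammaBessel_one_neg (1 - ν), neg_sub]
  field_simp
  ring

lemma ofReal_mul_cpow {t : ℝ} {z : ℂ} (ht : 0 < t) (hz : z ≠ 0) (a : ℂ) :
    ((t : ℂ) * z) ^ a = (t : ℂ) ^ a * z ^ a := by
  have ht0 : (t : ℂ) ≠ 0 := by exact_mod_cast ht.ne'
  rw [Complex.cpow_def_of_ne_zero (mul_ne_zero ht0 hz), Complex.cpow_def_of_ne_zero ht0,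
    Complex.cpow_def_of_ne_zero hz, Complex.log_ofReal_mul ht hz, ← Complex.exp_add,
    Complex.ofReal_log ht.le, add_mul]

lemma cpow_half_re_pos {w : ℂ} (hw : 0 < w.re) : 0 < (w ^ ((1 : ℂ) / 2)).re := by
  rw [one_div, Complex.cpow_inv_two_re]
  have := norm_nonneg w
  positivity

lemma cpow_half_cpow_mul_self (w a : ℂ) :
    (w ^ ((1 : ℂ) / 2)) ^ a * (w ^ ((1 : ℂ) / 2)) ^ a = w ^ a := by
  have him : (Complex.log w * (1 / 2)).im = w.arg / 2 := by
    rw [show (1 / 2 : ℂ) = ((1 / 2 : ℝ) : ℂ) by norm_num, Complex.im_mul_ofReal, Complex.log_im]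
    ring
  have h1 := Complex.neg_pi_lt_arg w
  have h2 := Complex.arg_le_pi w
  have h3 := Real.pi_pos
  rw [← Complex.cpow_mul _ (by rw [him]; linarith) (by rw [him]; linarith)]
  rcases eq_or_ne w 0 with rfl | hw
  · rcases eq_or_ne a 0 with rfl | ha
    · simp
    · simp [ha]
  · rw [← Complex.cpow_add _ _ hw]
    ring_nf

lemma deriv_cpow_mul_besselK {α t : ℝ} {z : ℂ} (C : ℂ) (hz : 0 < z.re) (ht : 0 < t) :
    deriv (fun s : ℝ => C * ((s * z / 2) ^ (α : ℂ)) * besselK α (s * z)) t =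
      -(C * (z / 2) * (t * z / 2) ^ (α : ℂ) * gammaBessel (1 - α) 1 (t * z / 2)) := by
  have hre {s : ℝ} (hs : 0 < s) : 0 < ((s : ℂ) * z / 2).re := by
    simp; positivity
  have hd : HasDerivAt (fun s : ℝ => C / 2 *
      ((s * z / 2) ^ (α : ℂ) * gammaBessel α 1 (s * z / 2)))
      (C / 2 * ((-2 * (t * z / 2) ^ (α : ℂ) * gammaBessel (1 - α) 1 (t * z / 2)) * (z / 2))) t := by
    refine HasDerivAt.const_mul _ ?_
    have h1 : HasDerivAt (fun s : ℝ => (s : ℂ) * z / 2) (z / 2) t := by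
      simpa using (((hasDerivAt_id' t).ofReal_comp.mul_const z).div_const 2)
    exact (hasDerivAt_cpow_mul_gammaBessel_one (hre ht)).comp t h1
  have heq : (fun s : ℝ => C * ((s * z / 2) ^ (α : ℂ)) * besselK α (s * z)) =ᶠ[𝓝 t]
      fun s : ℝ => C / 2 * ((s * z / 2) ^ (α : ℂ) * gammaBessel α 1 (s * z / 2)) := by
    filter_upwards [lt_mem_nhds ht] with s hs
    rw [besselK_eq_gammaBessel (by simp; positivity)]
    ring
  rw [heq.deriv_eq, hd.deriv]
  ring

/-- For `Re w > 0`, `g ∈ ℂ`, `0 < α < 1` real and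
`u(t) = (2g/Γ(α))(t√w/2)^α K_α(t√w)`, one has
`lim_{t→0+} (−t^{1-2α} u'(t)) = c_α w^α g` with `c_α = Γ(1-α)/(2^{2α-1}Γ(α))`. -/
theorem stmt19 (w g : ℂ) (α : ℝ) (hw : 0 < w.re) (h0 : 0 < α) (h1 : α < 1) :
    Tendsto (fun t : ℝ =>
        -(((t : ℂ) ^ ((1 : ℂ) - 2 * (α : ℂ))) *
          deriv (fun s : ℝ =>
            (2 * g / Complex.Gamma (α : ℂ)) *
              (((s : ℂ) * w ^ ((1:ℂ)/2) / 2) ^ (α : ℂ)) *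
              besselK (α : ℂ) ((s : ℂ) * w ^ ((1:ℂ)/2))) t))
      (𝓝[>] (0:ℝ))
      (𝓝 ((Complex.Gamma (1 - (α : ℂ)) / (2 ^ (2 * (α : ℂ) - 1) * Complex.Gamma (α : ℂ))) *
        w ^ (α : ℂ) * g)) := by

  set z := w ^ ((1 : ℂ) / 2) with hzdef
  have hz : 0 < z.re := cpow_half_re_pos hw
  have hz0 : z / 2 ≠ 0 := by
    intro h
    have : z = 0 := by simpa using h
    simp [this] at hz
  have hz2 : 0 < (z / 2).re := by simpa using hz
  have hlim := (tendsto_gammaBessel_sq (ν := 1 - α) (by linarith) hz2).const_mul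
    (2 * g / Complex.Gamma α * (z / 2) * (z / 2) ^ (α : ℂ))
  have hval : 2 * g / Complex.Gamma α * (z / 2) * (z / 2) ^ (α : ℂ) *
      (Complex.Gamma ((1 - α : ℝ) : ℂ) * (z / 2) ^ (-((1 - α : ℝ) : ℂ))) =
      Complex.Gamma (1 - (α : ℂ)) / (2 ^ (2 * (α : ℂ) - 1) * Complex.Gamma (α : ℂ)) *
        w ^ (α : ℂ) * g := by
    have h2 : (z / 2) ^ (α : ℂ) = z ^ (α : ℂ) / 2 ^ (α : ℂ) := by
      have hmul := ofReal_mul_cpow two_pos hz0 α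
      rw [Complex.ofReal_ofNat, mul_div_cancel₀ _ two_ne_zero] at hmul
      rw [hmul, mul_div_cancel_left₀ _ (by simp [Complex.cpow_eq_zero_iff])]
    have h3 : (z / 2) ^ (-((1 - α : ℝ) : ℂ)) = (z / 2) ^ (α : ℂ) / (z / 2) := by
      rw [show (-((1 - α : ℝ) : ℂ)) = (α : ℂ) - 1 by push_cast; ring,
        Complex.cpow_sub _ _ hz0, Complex.cpow_one]
    have h4 : (2 : ℂ) ^ (2 * (α : ℂ) - 1) = 2 ^ (α : ℂ) * 2 ^ (α : ℂ) / 2 := by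
      rw [Complex.cpow_sub _ _ two_ne_zero, Complex.cpow_one, two_mul,
        Complex.cpow_add _ _ two_ne_zero]
    have h5 : Complex.Gamma α ≠ 0 := Complex.Gamma_ne_zero_of_re_pos (by simpa using h0)
    have h6 : (2 : ℂ) ^ (α : ℂ) ≠ 0 := by simp [Complex.cpow_eq_zero_iff]
    have hz1 : z ≠ 0 := by rintro h; simp [h] at hz0
    rw [h3, h2, h4, ← cpow_half_cpow_mul_self w, ← hzdef, Complex.ofReal_sub, Complex.ofReal_one]
    field_simp
  rw [hval] at hlim
  refine hlim.congr' ?_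
  filter_upwards [self_mem_nhdsWithin] with t ht
  have ht' : 0 < t := ht
  have ht0 : (t : ℂ) ≠ 0 := by exact_mod_cast ht'.ne'
  rw [deriv_cpow_mul_besselK _ hz ht', gammaBessel_mul _ ht', mul_div_assoc (t : ℂ),
    ofReal_mul_cpow ht' hz0, show (((1 - α : ℝ) : ℂ)) = (1 - 2 * (α : ℂ)) + α by push_cast; ring,
    Complex.cpow_add _ _ ht0]
  ring
end
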